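/- arXiv:1805.00593 — 6 statements merged into one kernel-verified Lean document; each statement's English description precedes it below -/
import Mathlib

section
/- (Proposition 3.1 (i), value.) Let p ∈ ℝ³, η > 0, x ∈ ℝ³ and t ≥ 0 satisfy ||x − p| − t| < η and η < |x − p| + t. Then v(x,t) = (1/2)·{ η³/(6|x − p|) − η(|x − p| − t)²/(2|x − p|) + ||x − p| − t|³/(3|x − p|) }. -/
open MeasureTheory Real

noncomputable def PsiB (p : EuclideanSpace ℝ (Fin 3)) (η : ℝ)
    (x : EuclideanSpace ℝ (Fin 3)) : ℝ :=
  if ‖x - p‖ < η then η - ‖x - p‖ else 0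

/-- `v(x,t) = (t/(4π)) ∫_{S²} Ψ_B(x + tω) dσ(ω)`, where `σ = volume.toSphere` is the
surface measure on the unit sphere in `ℝ³` (total mass `4π`). -/
noncomputable def waveV (p : EuclideanSpace ℝ (Fin 3)) (η : ℝ)
    (x : EuclideanSpace ℝ (Fin 3)) (t : ℝ) : ℝ :=
  (t / (4 * π)) *
    ∫ ω : Metric.sphere (0 : EuclideanSpace ℝ (Fin 3)) 1,
      PsiB p η (x + t • (ω : EuclideanSpace ℝ (Fin 3)))
      ∂((volume : Measure (EuclideanSpace ℝ (Fin 3))).toSphere)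

open Set in
lemma aux_L2 (f : ℝ → ENNReal) (hf : Measurable f) :
    ∫⁻ q : ℝ × ℝ, f (q.1 ^ 2 + q.2 ^ 2) =
      ENNReal.ofReal (2 * π) * ∫⁻ r in Ioi (0:ℝ), ENNReal.ofReal r * f (r ^ 2) := by
  rw [← lintegral_comp_polarCoord_symm]
  simp only [polarCoord_target, polarCoord_symm_apply, smul_eq_mul]
  have hh : ∀ p : ℝ × ℝ, (p.1 * cos p.2) ^ 2 + (p.1 * sin p.2) ^ 2 = p.1 ^ 2 := by
    intro p
    have := Real.sin_sq_add_cos_sq p.2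
    linear_combination p.1 ^ 2 * this
  simp only [hh]
  rw [Measure.volume_eq_prod, ← Measure.prod_restrict, lintegral_prod _ (by fun_prop)]
  simp only [lintegral_const, Measure.restrict_apply_univ, Real.volume_Ioo]
  rw [lintegral_mul_const _ (by fun_prop), mul_comm]
  congr 2
  ring

open Set in
lemma aux_L3 (H : ℝ × ℝ → ENNReal) (hH : Measurable H) :
    ∫⁻ z : ℝ, ∫⁻ r in Ioi (0:ℝ), ENNReal.ofReal r * H (z, √(z ^ 2 + r ^ 2)) =
      ∫⁻ R in Ioi (0:ℝ), ∫⁻ φ in Ioo 0 π,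
        ENNReal.ofReal R * (ENNReal.ofReal (R * sin φ) * H (R * cos φ, R)) := by
  have e1 : ∫⁻ z : ℝ, ∫⁻ r in Ioi (0:ℝ), ENNReal.ofReal r * H (z, √(z ^ 2 + r ^ 2)) =
      ∫⁻ q : ℝ × ℝ, ENNReal.ofReal q.2 * H (q.1, √(q.1 ^ 2 + q.2 ^ 2)) := by
    rw [Measure.volume_eq_prod, lintegral_prod _ (by fun_prop)]
    refine lintegral_congr fun z => ?_
    refine setLIntegral_eq_of_support_subset ?_
    intro r hr
    by_contra h
    simp only [mem_Ioi, not_lt] at h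
    apply hr
    simp [ENNReal.ofReal_of_nonpos h]
  rw [e1, ← lintegral_comp_polarCoord_symm]
  simp only [polarCoord_target, polarCoord_symm_apply, smul_eq_mul]
  have hh : ∀ p : ℝ × ℝ, (p.1 * cos p.2) ^ 2 + (p.1 * sin p.2) ^ 2 = p.1 ^ 2 := by
    intro p
    have := Real.sin_sq_add_cos_sq p.2
    linear_combination p.1 ^ 2 * this
  simp only [hh]
  rw [Measure.volume_eq_prod, ← Measure.prod_restrict, lintegral_prod _ (by fun_prop)]
  refine setLIntegral_congr_fun measurableSet_Ioi fun R hR => ?_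
  have hR' : (0:ℝ) < R := hR
  simp only [Real.sqrt_sq hR'.le]
  symm
  have : Ioo 0 π = Ioo (0:ℝ) π ∩ Ioo (-π) π := by
    ext x; simp only [mem_Ioo, mem_inter_iff]; constructor
    · rintro ⟨h1, h2⟩; exact ⟨⟨h1, h2⟩, by linarith, h2⟩
    · exact fun h => h.1
  rw [this, ← Measure.restrict_restrict measurableSet_Ioo, ← lintegral_indicator measurableSet_Ioo]
  refine setLIntegral_congr_fun measurableSet_Ioo fun φ hφ => ?_
  by_cases h : φ ∈ Ioo 0 π
  · simp [indicator_of_mem h]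
  · rw [indicator_of_notMem h]
    have : sin φ ≤ 0 := by
      apply Real.sin_nonpos_of_nonpos_of_neg_pi_le
      · by_contra h'; exact h ⟨not_le.1 h', hφ.2⟩
      · exact hφ.1.le
    rw [ENNReal.ofReal_of_nonpos (mul_nonpos_of_nonneg_of_nonpos hR'.le this)]
    simp

open Set in
lemma aux_L1 (H : ℝ × ℝ → ENNReal) (hH : Measurable H) :
    ∫⁻ y : EuclideanSpace ℝ (Fin 3), H (y 0, ‖y‖) =
      ∫⁻ z : ℝ, ∫⁻ q : ℝ × ℝ, H (z, √(z ^ 2 + (q.1 ^ 2 + q.2 ^ 2))) := by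
  have m1 := EuclideanSpace.volume_preserving_symm_measurableEquiv_toLp (Fin 3)
  have m2 := volume_preserving_piFinSuccAbove (fun _ : Fin 3 => ℝ) 0
  have m3 := (volume_preserving_finTwoArrow ℝ)
  have e1 := m1.lintegral_comp_emb (MeasurableEquiv.measurableEmbedding _)
    (fun y : Fin 3 → ℝ => H (y 0, √(y 0 ^ 2 + (y 1 ^ 2 + y 2 ^ 2))))
  have e2 := m2.lintegral_comp_emb (MeasurableEquiv.measurableEmbedding _)
    (fun y : ℝ × (Fin 2 → ℝ) => H (y.1, √(y.1 ^ 2 + (y.2 0 ^ 2 + y.2 1 ^ 2))))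
  have e3 := fun z : ℝ => m3.lintegral_comp_emb (MeasurableEquiv.measurableEmbedding _)
    (fun q : ℝ × ℝ => H (z, √(z ^ 2 + (q.1 ^ 2 + q.2 ^ 2))))
  simp only [← e3]
  trans
  · trans
    swap
    · exact e1
    · refine lintegral_congr fun y => ?_
      rw [EuclideanSpace.norm_eq, Fin.sum_univ_three]
      simp [add_assoc]
  · trans
    · exact e2
    · rw [Measure.volume_eq_prod, lintegral_prod _ (by fun_prop)]
      rfl

open Set in
lemma aux_rot (u : EuclideanSpace ℝ (Fin 3)) (hu : ‖u‖ = 1) (H : ℝ × ℝ → ENNReal) :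
    ∫⁻ y : EuclideanSpace ℝ (Fin 3), H (inner ℝ u y, ‖y‖) =
    ∫⁻ y : EuclideanSpace ℝ (Fin 3), H (y 0, ‖y‖) := by
  set e : EuclideanSpace ℝ (Fin 3) := EuclideanSpace.single 0 1
  have he : ‖u‖ = ‖e‖ := by simp [e, hu]
  have hR := Submodule.reflection_sub he
  set R := (ℝ ∙ (u - e))ᗮ.reflection
  rw [← R.measurePreserving.lintegral_comp_emb R.toHomeomorph.measurableEmbedding
    (fun y => H (y 0, ‖y‖))]
  refine lintegral_congr fun y => ?_
  have : (R y) 0 = inner ℝ u y := by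
    rw [← R.inner_map_map, hR]
    simp [e, EuclideanSpace.inner_single_left]
  rw [this, R.norm_map]

open Set in
lemma aux_polar (u : EuclideanSpace ℝ (Fin 3)) (g : ℝ → ENNReal) (hg : Measurable g) :
    ∫⁻ y : EuclideanSpace ℝ (Fin 3), (if ‖y‖ < 1 then g (inner ℝ u y / ‖y‖) else 0) =
    (∫⁻ ω : Metric.sphere (0 : EuclideanSpace ℝ (Fin 3)) 1, g (inner ℝ u (ω : EuclideanSpace ℝ (Fin 3)))
      ∂((volume : Measure (EuclideanSpace ℝ (Fin 3))).toSphere)) * ENNReal.ofReal (1/3) := by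
  have hm := (volume : Measure (EuclideanSpace ℝ (Fin 3))).measurePreserving_homeomorphUnitSphereProd
  have e1 := hm.lintegral_comp_emb (Homeomorph.measurableEmbedding _)
    (fun q => g (inner ℝ u (q.1 : EuclideanSpace ℝ (Fin 3))) *
      (Iio (⟨1, mem_Ioi.2 one_pos⟩ : Ioi (0:ℝ))).indicator (fun _ => 1) q.2)
  rw [lintegral_prod_mul
    (f := fun ω : Metric.sphere (0 : EuclideanSpace ℝ (Fin 3)) 1 =>
      g (inner ℝ u (ω : EuclideanSpace ℝ (Fin 3))))
    (g := (Iio (⟨1, mem_Ioi.2 one_pos⟩ : Ioi (0:ℝ))).indicator (fun _ => 1)) (by fun_prop)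
    (by exact (measurable_const.indicator measurableSet_Iio).aemeasurable),
    lintegral_indicator measurableSet_Iio, setLIntegral_const, one_mul,
    Measure.volumeIoiPow_apply_Iio] at e1
  rw [← restrict_compl_singleton (μ := (volume : Measure (EuclideanSpace ℝ (Fin 3)))) 0,
    ← lintegral_subtype_comap (measurableSet_singleton _).compl]
  trans
  swap
  · trans
    · exact e1
    · congr 2
      · rw [restrict_compl_singleton]
      · rw [finrank_euclideanSpace_fin]
        norm_num
  · refine lintegral_congr fun y => ?_
    have hy : ‖(y : EuclideanSpace ℝ (Fin 3))‖ ≠ 0 := norm_ne_zero_iff.2 y.2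
    simp only [indicator, mem_Iio, ← Subtype.coe_lt_coe, homeomorphUnitSphereProd_apply_snd_coe,
      homeomorphUnitSphereProd_apply_fst_coe, inner_smul_right]
    split_ifs
    · rw [mul_one, div_eq_inv_mul]
    · simp

open Set in
lemma aux_archimedes (u : EuclideanSpace ℝ (Fin 3)) (hu : ‖u‖ = 1) (g : ℝ → ENNReal)
    (hg : Measurable g) :
    ∫⁻ ω : Metric.sphere (0 : EuclideanSpace ℝ (Fin 3)) 1, g (inner ℝ u (ω : EuclideanSpace ℝ (Fin 3)))
      ∂((volume : Measure (EuclideanSpace ℝ (Fin 3))).toSphere) =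
    ENNReal.ofReal (2 * π) * ∫⁻ φ in Ioo 0 π, ENNReal.ofReal (sin φ) * g (cos φ) := by
  have h0 := aux_polar u g hg
  set H : ℝ × ℝ → ENNReal := fun q => if q.2 < 1 then g (q.1 / q.2) else 0 with hHdef
  have hH : Measurable H :=
    Measurable.ite (measurableSet_lt measurable_snd measurable_const) (by fun_prop) measurable_const
  have h1 := aux_rot u hu H
  rw [aux_L1 H hH] at h1
  have h2 : ∀ z : ℝ, ∫⁻ q : ℝ × ℝ, H (z, √(z ^ 2 + (q.1 ^ 2 + q.2 ^ 2))) =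
    ENNReal.ofReal (2 * π) * ∫⁻ r in Ioi (0:ℝ), ENNReal.ofReal r * H (z, √(z ^ 2 + r ^ 2)) :=
    fun z => aux_L2 (fun s => H (z, √(z ^ 2 + s))) (by fun_prop)
  simp only [h2] at h1
  rw [lintegral_const_mul' _ _ ENNReal.ofReal_ne_top, aux_L3 H hH] at h1
  have h3 : ∫⁻ R in Ioi (0:ℝ), ∫⁻ φ in Ioo 0 π,
        ENNReal.ofReal R * (ENNReal.ofReal (R * sin φ) * H (R * cos φ, R)) =
      ENNReal.ofReal (1/3) * ∫⁻ φ in Ioo 0 π, ENNReal.ofReal (sin φ) * g (cos φ) := by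
    have : ∀ R ∈ Ioi (0:ℝ), ∫⁻ φ in Ioo 0 π,
        ENNReal.ofReal R * (ENNReal.ofReal (R * sin φ) * H (R * cos φ, R)) =
        (Iio (1:ℝ)).indicator (fun R => ENNReal.ofReal (R ^ 2)) R *
          ∫⁻ φ in Ioo 0 π, ENNReal.ofReal (sin φ) * g (cos φ) := by
      intro R hR
      have hR' : (0:ℝ) < R := hR
      rw [← lintegral_const_mul _ (by fun_prop)]
      refine lintegral_congr fun φ => ?_
      by_cases h : R < 1
      · simp only [hHdef, indicator, mem_Iio, h, if_true]
        rw [mul_div_cancel_left₀ _ hR'.ne', ENNReal.ofReal_mul hR'.le, pow_two,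
          ENNReal.ofReal_mul hR'.le]
        ring
      · simp [hHdef, indicator, h]
    rw [setLIntegral_congr_fun measurableSet_Ioi this, lintegral_mul_const _
      ((by fun_prop : Measurable fun R : ℝ => ENNReal.ofReal (R ^ 2)).indicator measurableSet_Iio),
      lintegral_indicator measurableSet_Iio, Measure.restrict_restrict measurableSet_Iio]
    congr 1
    rw [inter_comm, Ioi_inter_Iio, Measure.restrict_congr_set Ioo_ae_eq_Ioc,
      ← ofReal_integral_eq_lintegral_ofReal (by
          exact (intervalIntegral.intervalIntegrable_pow (μ := volume) (a := 0) (b := 1) 2).1)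
        (Filter.Eventually.of_forall fun _ => sq_nonneg _),
      ← intervalIntegral.integral_of_le zero_le_one, integral_pow]
    norm_num
  rw [h3] at h1
  have h4 := h0.symm.trans h1
  rw [mul_left_comm, mul_comm] at h4
  refine (ENNReal.mul_right_inj ?_ ENNReal.ofReal_ne_top).1 h4
  simp

lemma aux_int (a t η : ℝ) (ha : 0 < a) (ht : 0 < t) 
    (h1 : |a - t| < η) (h2 : η < a + t) :
    ∫ φ in (0:ℝ)..π, sin φ * max (η - √(a ^ 2 + t ^ 2 + 2 * a * t * cos φ)) 0 =
      1 / (a * t) * (η ^ 3 / 6 - η * (a - t) ^ 2 / 2 + |a - t| ^ 3 / 3) := by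
  have e1 := intervalIntegral.integral_comp_mul_deriv (a := 0) (b := π)
    (f := fun φ => a ^ 2 + t ^ 2 + 2 * a * t * cos φ) (f' := fun φ => - (2 * a * t * sin φ))
    (g := fun q => max (η - √q) 0) 
    (fun x _ => by simpa using ((hasDerivAt_cos x).const_mul (2 * a * t)).const_add (a ^ 2 + t ^ 2))
    (by fun_prop) (by fun_prop)
  have e2 := intervalIntegral.integral_comp_mul_deriv (a := |a - t|) (b := a + t)
    (f := fun r => r ^ 2) (f' := fun r => 2 * r)
    (g := fun q => max (η - √q) 0) 
    (fun x _ => by simpa using hasDerivAt_pow 2 x)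
    (by fun_prop) (by fun_prop)
  have e3 : ∫ r in |a - t|..(a + t), max (η - √(r ^ 2)) 0 * (2 * r) =
      2 * (η ^ 3 / 6 - η * (a - t) ^ 2 / 2 + |a - t| ^ 3 / 3) := by
    have hc : Continuous fun r : ℝ => max (η - √(r ^ 2)) 0 * (2 * r) := by fun_prop
    rw [← intervalIntegral.integral_add_adjacent_intervals (b := η)
      (hc.intervalIntegrable _ _) (hc.intervalIntegrable _ _)]
    have s1 : ∫ r in |a - t|..η, max (η - √(r ^ 2)) 0 * (2 * r) =
        ∫ r in |a - t|..η, (2 * η * r - 2 * r ^ 2) := by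
      refine intervalIntegral.integral_congr fun r hr => ?_
      rw [Set.uIcc_of_le h1.le] at hr
      rw [Real.sqrt_sq ((abs_nonneg _).trans hr.1), max_eq_left (by linarith [hr.2])]
      ring
    have s2 : ∫ r in η..(a + t), max (η - √(r ^ 2)) 0 * (2 * r) = ∫ r in η..(a + t), (0:ℝ) := by
      refine intervalIntegral.integral_congr fun r hr => ?_
      rw [Set.uIcc_of_le h2.le] at hr
      rw [Real.sqrt_sq (by linarith [hr.1, abs_nonneg (a - t)]), max_eq_right (by linarith [hr.1])]
      ring
    rw [s1, s2, intervalIntegral.integral_sub (Continuous.intervalIntegrable (by fun_prop) _ _)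
      (Continuous.intervalIntegrable (by fun_prop) _ _), intervalIntegral.integral_const_mul,
      intervalIntegral.integral_const_mul, integral_id, integral_pow, ← sq_abs (a - t)]
    simp
    ring
  simp only [Function.comp_def] at e1 e2
  rw [e3] at e2
  simp only [cos_zero, cos_pi, sq_abs] at e1 e2
  rw [show a ^ 2 + t ^ 2 + 2 * a * t * 1 = (a + t) ^ 2 by ring,
    show a ^ 2 + t ^ 2 + 2 * a * t * -1 = (a - t) ^ 2 by ring,
    intervalIntegral.integral_symm ((a - t) ^ 2), ← e2] at e1
  have e4 : ∫ φ in (0:ℝ)..π, max (η - √(a ^ 2 + t ^ 2 + 2 * a * t * cos φ)) 0 * -(2 * a * t * sin φ)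
      = -(2 * a * t) * 
        ∫ φ in (0:ℝ)..π, sin φ * max (η - √(a ^ 2 + t ^ 2 + 2 * a * t * cos φ)) 0 := by
    rw [← intervalIntegral.integral_const_mul]
    congr 1; ext φ; ring
  rw [e4] at e1
  generalize (∫ φ in (0:ℝ)..π, sin φ * max (η - √(a ^ 2 + t ^ 2 + 2 * a * t * cos φ)) 0) = J at *
  rw [one_div, eq_inv_mul_iff_mul_eq₀ (mul_pos ha ht).ne']
  linarith

/-- Proposition 3.1 (i), value. -/
theorem stmt_2 (p : EuclideanSpace ℝ (Fin 3)) (η : ℝ) (hη : 0 < η)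
    (x : EuclideanSpace ℝ (Fin 3)) (t : ℝ) (ht : 0 ≤ t)
    (h1 : |‖x - p‖ - t| < η) (h2 : η < ‖x - p‖ + t) :
    waveV p η x t =
      (1 / 2) * (η ^ 3 / (6 * ‖x - p‖)
        - η * (‖x - p‖ - t) ^ 2 / (2 * ‖x - p‖)
        + |‖x - p‖ - t| ^ 3 / (3 * ‖x - p‖)) := by
  have h1' := abs_lt.1 h1
  have ht' : 0 < t := by linarith
  have ha : 0 < ‖x - p‖ := by linarith
  set a := ‖x - p‖ with hadef
  set u : EuclideanSpace ℝ (Fin 3) := a⁻¹ • (x - p) with hudef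
  have hu : ‖u‖ = 1 := by
    rw [hudef, norm_smul, ← hadef, norm_inv, Real.norm_of_nonneg ha.le, inv_mul_cancel₀ ha.ne']
  have hxu : x - p = a • u := by rw [hudef, smul_inv_smul₀ ha.ne']
  have hψ : ∀ ω : Metric.sphere (0 : EuclideanSpace ℝ (Fin 3)) 1,
      PsiB p η (x + t • (ω : EuclideanSpace ℝ (Fin 3))) =
      max (η - √(a ^ 2 + t ^ 2 + 2 * a * t * inner ℝ u (ω : EuclideanSpace ℝ (Fin 3)))) 0 := by
    intro ω
    have hω : ‖(ω : EuclideanSpace ℝ (Fin 3))‖ = 1 := by simpa using ω.2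
    have hn : ‖x + t • (ω : EuclideanSpace ℝ (Fin 3)) - p‖ =
        √(a ^ 2 + t ^ 2 + 2 * a * t * inner ℝ u (ω : EuclideanSpace ℝ (Fin 3))) := by
      rw [← Real.sqrt_sq (norm_nonneg (x + t • (ω : EuclideanSpace ℝ (Fin 3)) - p)),
        show x + t • (ω : EuclideanSpace ℝ (Fin 3)) - p = a • u + t • (ω : EuclideanSpace ℝ (Fin 3)) by
          rw [← hxu]; abel,
        norm_add_sq_real, norm_smul a u, norm_smul t, hu, hω, inner_smul_left, inner_smul_right,
        Real.norm_of_nonneg ha.le, Real.norm_of_nonneg ht]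
      congr 1
      simp
      ring
    unfold PsiB
    rw [hn]
    split_ifs with h
    · rw [max_eq_left (by linarith)]
    · rw [max_eq_right (by linarith)]
  have key := aux_archimedes u hu
    (fun s => ENNReal.ofReal (max (η - √(a ^ 2 + t ^ 2 + 2 * a * t * s)) 0)) (by fun_prop)
  unfold waveV
  simp only [hψ]
  have hcw : Continuous fun ω : Metric.sphere (0 : EuclideanSpace ℝ (Fin 3)) 1 =>
      max (η - √(a ^ 2 + t ^ 2 + 2 * a * t * inner ℝ u (ω : EuclideanSpace ℝ (Fin 3)))) 0 := by
    fun_prop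
  rw [integral_eq_lintegral_of_nonneg_ae
    (f := fun ω : Metric.sphere (0 : EuclideanSpace ℝ (Fin 3)) 1 =>
      max (η - √(a ^ 2 + t ^ 2 + 2 * a * t * inner ℝ u (ω : EuclideanSpace ℝ (Fin 3)))) 0)
    (Filter.Eventually.of_forall fun _ => le_max_right _ _) hcw.aestronglyMeasurable, key]
  have h5 : ∫⁻ φ in Set.Ioo 0 π, ENNReal.ofReal (sin φ) *
      ENNReal.ofReal (max (η - √(a ^ 2 + t ^ 2 + 2 * a * t * cos φ)) 0) =
      ENNReal.ofReal (∫ φ in (0:ℝ)..π,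
        sin φ * max (η - √(a ^ 2 + t ^ 2 + 2 * a * t * cos φ)) 0) := by
    have hc : Continuous fun φ => sin φ * max (η - √(a ^ 2 + t ^ 2 + 2 * a * t * cos φ)) 0 := by
      fun_prop
    rw [intervalIntegral.integral_of_le pi_pos.le, ← Measure.restrict_congr_set Ioo_ae_eq_Ioc,
      ofReal_integral_eq_lintegral_ofReal]
    · refine setLIntegral_congr_fun measurableSet_Ioo fun φ hφ => ?_
      exact (ENNReal.ofReal_mul (sin_nonneg_of_mem_Icc ⟨hφ.1.le, hφ.2.le⟩)).symm
    · exact (hc.integrableOn_Icc (a := 0) (b := π)).mono_set Set.Ioo_subset_Icc_self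
    · filter_upwards [ae_restrict_mem measurableSet_Ioo] with φ hφ
      exact mul_nonneg (sin_nonneg_of_mem_Icc ⟨hφ.1.le, hφ.2.le⟩) (le_max_right _ _)
  have h6 : 0 ≤ ∫ φ in (0:ℝ)..π,
        sin φ * max (η - √(a ^ 2 + t ^ 2 + 2 * a * t * cos φ)) 0 :=
    intervalIntegral.integral_nonneg pi_pos.le fun φ hφ =>
      mul_nonneg (sin_nonneg_of_mem_Icc hφ) (le_max_right _ _)
  rw [h5, ENNReal.toReal_mul, ENNReal.toReal_ofReal (by positivity), ENNReal.toReal_ofReal h6,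
    aux_int a t η ha ht' h1 h2]
  have := pi_pos
  field_simp
  ring
end

section
/- (Proposition 3.1 (i), time derivative.) Let p ∈ ℝ³, η > 0, x ∈ ℝ³ and t > 0 satisfy ||x − p| − t| < η and η < |x − p| + t. Then the function s ↦ v(x,s) is differentiable at s = t with derivative ∂_t v(x,t) = ((|x − p| − t)/(2|x − p|))·(η − ||x − p| − t|). -/
open MeasureTheory Real

open Set


lemma gauss_half (n : ℕ) :
    ∫ x in Ioi (0 : ℝ), x ^ n * exp (-x ^ 2) = (1 / 2) * Gamma (((n : ℝ) + 1) / 2) := by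
  have h := integral_rpow_mul_exp_neg_rpow (p := 2) (q := n) (by norm_num)
    (by have : (0:ℝ) ≤ n := n.cast_nonneg
        linarith)
  rw [← h]
  refine setIntegral_congr_fun measurableSet_Ioi (fun x _ => ?_)
  simp only [rpow_natCast]
  congr 3
  norm_cast

lemma gauss_half_rec (n : ℕ) :
    ∫ x in Ioi (0 : ℝ), x ^ (n + 2) * exp (-x ^ 2)
      = ((n : ℝ) + 1) / 2 * ∫ x in Ioi (0 : ℝ), x ^ n * exp (-x ^ 2) := by
  rw [gauss_half, gauss_half]
  have h0 : ((n : ℝ) + 1) / 2 ≠ 0 := by positivity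
  have : (((n + 2 : ℕ) : ℝ) + 1) / 2 = ((n : ℝ) + 1) / 2 + 1 := by push_cast; ring
  rw [this, Gamma_add_one h0]
  ring

lemma gauss_half_pos (n : ℕ) : 0 < ∫ x in Ioi (0 : ℝ), x ^ n * exp (-x ^ 2) := by
  rw [gauss_half]
  have := Gamma_pos_of_pos (s := ((n : ℝ) + 1) / 2) (by positivity)
  positivity

lemma gauss_full (n : ℕ) :
    ∫ x : ℝ, x ^ n * exp (-x ^ 2)
      = (1 + (-1) ^ n) * ∫ x in Ioi (0 : ℝ), x ^ n * exp (-x ^ 2) := by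
  rcases Nat.even_or_odd n with hn | hn
  · rw [hn.neg_one_pow]
    have h := integral_comp_abs (f := fun x => x ^ n * exp (-x ^ 2))
    simp only [hn.pow_abs, sq_abs] at h
    rw [h]; norm_num
  · rw [hn.neg_one_pow]
    have h := integral_neg_eq_self (fun x : ℝ => x ^ n * exp (-x ^ 2)) volume
    simp only [hn.neg_pow, neg_mul, neg_sq, integral_neg] at h
    linarith

lemma sphere_polar (f : (EuclideanSpace ℝ (Fin 3)) → ℝ) (g : ℝ → ℝ) (F : (EuclideanSpace ℝ (Fin 3)) → ℝ)
    (hF : ∀ (ω : Metric.sphere (0 : (EuclideanSpace ℝ (Fin 3))) 1) (r : ℝ), 0 < r → F (r • (ω : (EuclideanSpace ℝ (Fin 3)))) = f ω * g r) :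
    ∫ x, F x = (∫ ω : Metric.sphere (0 : (EuclideanSpace ℝ (Fin 3))) 1, f ω ∂(volume : Measure (EuclideanSpace ℝ (Fin 3))).toSphere)
      * ∫ r in Ioi (0 : ℝ), r ^ 2 * g r := by
  calc
    ∫ x, F x = ∫ x : ({(0)}ᶜ : Set (EuclideanSpace ℝ (Fin 3))), F x.1 ∂((volume : Measure (EuclideanSpace ℝ (Fin 3))).comap (↑)) := by
      rw [integral_subtype_comap (measurableSet_singleton _).compl fun x ↦ F x,
        restrict_compl_singleton]
    _ = ∫ x : Metric.sphere (0 : (EuclideanSpace ℝ (Fin 3))) 1 × Ioi (0 : ℝ), f x.1 * g x.2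
          ∂(volume : Measure (EuclideanSpace ℝ (Fin 3))).toSphere.prod (.volumeIoiPow (Module.finrank ℝ (EuclideanSpace ℝ (Fin 3)) - 1)) := by
      rw [← (volume : Measure (EuclideanSpace ℝ (Fin 3))).measurePreserving_homeomorphUnitSphereProd.integral_comp
        (Homeomorph.measurableEmbedding _)]
      refine integral_congr_ae (Filter.Eventually.of_forall fun x => ?_)
      have h := hF (homeomorphUnitSphereProd (EuclideanSpace ℝ (Fin 3)) x).1 (homeomorphUnitSphereProd (EuclideanSpace ℝ (Fin 3)) x).2
        (homeomorphUnitSphereProd (EuclideanSpace ℝ (Fin 3)) x).2.2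
      simp only
      rw [← h]
      congr 1
      have : x = (homeomorphUnitSphereProd (EuclideanSpace ℝ (Fin 3))).symm (homeomorphUnitSphereProd (EuclideanSpace ℝ (Fin 3)) x) := by simp
      conv_lhs => rw [this]
      simp [-Homeomorph.symm_apply_apply]
    _ = (∫ ω : Metric.sphere (0 : (EuclideanSpace ℝ (Fin 3))) 1, f ω ∂(volume : Measure (EuclideanSpace ℝ (Fin 3))).toSphere)
        * ∫ x : Ioi (0 : ℝ), g x ∂.volumeIoiPow (Module.finrank ℝ (EuclideanSpace ℝ (Fin 3)) - 1) :=
      integral_prod_mul (fun ω : Metric.sphere (0 : (EuclideanSpace ℝ (Fin 3))) 1 => f ω) (fun x : Ioi (0 : ℝ) => g x)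
    _ = _ := by
      congr 1
      simp only [Measure.volumeIoiPow, ENNReal.ofReal]
      rw [integral_withDensity_eq_integral_smul,
        integral_subtype_comap measurableSet_Ioi fun a ↦
          Real.toNNReal (a ^ (Module.finrank ℝ (EuclideanSpace ℝ (Fin 3)) - 1)) • g a,
        setIntegral_congr_fun measurableSet_Ioi fun x hx ↦ ?_]
      · rw [NNReal.smul_def, Real.coe_toNNReal _ (pow_nonneg hx.out.le _)]
        simp
      · exact (measurable_subtype_coe.pow_const _).real_toNNReal

lemma gauss_three (e : (EuclideanSpace ℝ (Fin 3))) (he : ‖e‖ = 1) (n : ℕ) :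
    ∫ x : (EuclideanSpace ℝ (Fin 3)), (inner ℝ e x) ^ n * exp (-‖x‖ ^ 2)
      = (∫ x : ℝ, x ^ n * exp (-x ^ 2)) * π := by
  obtain ⟨b, hb⟩ := Orthonormal.exists_orthonormalBasis_extension_of_card_eq (𝕜 := ℝ) (E := (EuclideanSpace ℝ (Fin 3)))
    (ι := Fin 3) (by simp) (v := fun _ => e) (s := {0}) (by
      rw [orthonormal_iff_ite]
      rintro ⟨i, rfl⟩ ⟨j, rfl⟩
      simp [he])
  have hb0 : b 0 = e := hb 0 rfl
  have h1 : ∫ x : (EuclideanSpace ℝ (Fin 3)), (inner ℝ e x) ^ n * exp (-‖x‖ ^ 2)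
      = ∫ y : (EuclideanSpace ℝ (Fin 3)), (y 0) ^ n * exp (-‖y‖ ^ 2) := by
    rw [← b.measurePreserving_repr.integral_comp b.repr.toHomeomorph.measurableEmbedding
      (fun y : (EuclideanSpace ℝ (Fin 3)) => (y 0) ^ n * exp (-‖y‖ ^ 2))]
    refine integral_congr_ae (Filter.Eventually.of_forall fun x => ?_)
    simp [b.repr_apply_apply, hb0]
  have h2 : ∫ y : (EuclideanSpace ℝ (Fin 3)), (y 0) ^ n * exp (-‖y‖ ^ 2)
      = ∫ y : Fin 3 → ℝ, ∏ i, (if i = 0 then (y i) ^ n * exp (-(y i) ^ 2) else exp (-(y i)^2)) := by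
    rw [← (PiLp.volume_preserving_toLp (Fin 3)).integral_comp
      (MeasurableEquiv.toLp 2 (Fin 3 → ℝ)).measurableEmbedding]
    refine integral_congr_ae (Filter.Eventually.of_forall fun x => ?_)
    simp only [EuclideanSpace.norm_sq_eq, Fin.prod_univ_three, Fin.sum_univ_three]
    simp [neg_add, exp_add]
    ring
  rw [h1, h2, integral_fintype_prod_volume_eq_prod
    (f := fun (i : Fin 3) (z : ℝ) => if i = 0 then z ^ n * exp (-z ^ 2) else exp (-z^2))]
  have h3 : ∫ z : ℝ, exp (-z ^ 2) = √π := by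
    simpa using integral_gaussian 1
  simp only [Fin.prod_univ_three]
  simp [h3]
  rw [mul_assoc, Real.mul_self_sqrt pi_pos.le]

lemma sphere_moment (e : (EuclideanSpace ℝ (Fin 3))) (he : ‖e‖ = 1) (n : ℕ) :
    ∫ ω : Metric.sphere (0 : (EuclideanSpace ℝ (Fin 3))) 1, (inner ℝ e (ω : (EuclideanSpace ℝ (Fin 3)))) ^ n ∂(volume : Measure (EuclideanSpace ℝ (Fin 3))).toSphere
      = 2 * π * ∫ u in (-1 : ℝ)..1, u ^ n := by
  have h := sphere_polar (fun x => (inner ℝ e x) ^ n) (fun r => r ^ n * exp (-r ^ 2))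
    (fun x => (inner ℝ e x) ^ n * exp (-‖x‖ ^ 2)) (by
      intro ω r hr
      have : ‖(ω : (EuclideanSpace ℝ (Fin 3)))‖ = 1 := by simpa using ω.2
      simp [inner_smul_right, norm_smul, this, mul_pow]
      ring)
  rw [gauss_three e he, gauss_full] at h
  have h2 : ∫ r in Ioi (0 : ℝ), r ^ 2 * (r ^ n * exp (-r ^ 2))
      = ((n : ℝ) + 1) / 2 * ∫ x in Ioi (0 : ℝ), x ^ n * exp (-x ^ 2) := by
    rw [← gauss_half_rec]
    congr 1; ext r; ring
  rw [h2] at h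
  have h3 := gauss_half_pos n
  set J := ∫ x in Ioi (0 : ℝ), x ^ n * exp (-x ^ 2)
  have hn : (0:ℝ) < (n : ℝ) + 1 := by positivity
  rw [integral_pow]
  have h4 : (1 + (-1 : ℝ) ^ n) * π = (∫ ω : Metric.sphere (0 : (EuclideanSpace ℝ (Fin 3))) 1,
      (inner ℝ e (ω : (EuclideanSpace ℝ (Fin 3)))) ^ n ∂(volume : Measure (EuclideanSpace ℝ (Fin 3))).toSphere) * (((n : ℝ) + 1) / 2) := by
    apply mul_right_cancel₀ h3.ne'
    linarith
  rw [pow_succ (-1 : ℝ)]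
  field_simp
  simp only [one_pow]
  linarith

lemma sphere_cont (e : (EuclideanSpace ℝ (Fin 3))) (he : ‖e‖ = 1) (k : ℝ → ℝ) (hk : Continuous k) :
    ∫ ω : Metric.sphere (0 : (EuclideanSpace ℝ (Fin 3))) 1, k (inner ℝ e (ω : (EuclideanSpace ℝ (Fin 3)))) ∂(volume : Measure (EuclideanSpace ℝ (Fin 3))).toSphere
      = 2 * π * ∫ u in (-1 : ℝ)..1, k u := by
  have hmem : ∀ ω : Metric.sphere (0 : (EuclideanSpace ℝ (Fin 3))) 1, inner ℝ e (ω : (EuclideanSpace ℝ (Fin 3))) ∈ Icc (-1 : ℝ) 1 := by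
    intro ω
    have h := abs_real_inner_le_norm e (ω : (EuclideanSpace ℝ (Fin 3)))
    have : ‖(ω : (EuclideanSpace ℝ (Fin 3)))‖ = 1 := by simpa using ω.2
    rw [he, this, one_mul] at h
    exact abs_le.1 h
  have hint : ∀ k : ℝ → ℝ, Continuous k → Integrable
      (fun ω : Metric.sphere (0 : (EuclideanSpace ℝ (Fin 3))) 1 => k (inner ℝ e (ω : (EuclideanSpace ℝ (Fin 3)))))
      (volume : Measure (EuclideanSpace ℝ (Fin 3))).toSphere := by
    intro k hk
    apply Continuous.integrable_of_hasCompactSupport (by fun_prop)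
    exact HasCompactSupport.of_compactSpace _
  have hpoly : ∀ P : Polynomial ℝ,
      ∫ ω : Metric.sphere (0 : (EuclideanSpace ℝ (Fin 3))) 1, P.eval (inner ℝ e (ω : (EuclideanSpace ℝ (Fin 3)))) ∂(volume : Measure (EuclideanSpace ℝ (Fin 3))).toSphere
      = 2 * π * ∫ u in (-1 : ℝ)..1, P.eval u := by
    intro P
    induction P using Polynomial.induction_on' with
    | add P Q hP hQ =>
      simp only [Polynomial.eval_add]
      rw [integral_add (hint _ P.continuous) (hint _ Q.continuous),
        intervalIntegral.integral_add (P.continuous.intervalIntegrable _ _)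
          (Q.continuous.intervalIntegrable _ _), hP, hQ, mul_add]
    | monomial n a =>
      simp only [Polynomial.eval_monomial]
      rw [integral_const_mul, intervalIntegral.integral_const_mul, sphere_moment e he]
      ring
  set σ := (volume : Measure (EuclideanSpace ℝ (Fin 3))).toSphere
  set M := σ.real univ
  have hM : 0 ≤ M := measureReal_nonneg
  have key : ∀ ε > 0, |∫ ω : Metric.sphere (0 : (EuclideanSpace ℝ (Fin 3))) 1, k (inner ℝ e (ω : (EuclideanSpace ℝ (Fin 3)))) ∂σ
      - 2 * π * ∫ u in (-1 : ℝ)..1, k u| ≤ ε * (M + 4 * π) := by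
    intro ε hε
    obtain ⟨P, hP⟩ := exists_polynomial_near_of_continuousOn (-1) 1 k hk.continuousOn ε hε
    have h1 : |∫ ω : Metric.sphere (0 : (EuclideanSpace ℝ (Fin 3))) 1, (P.eval (inner ℝ e (ω : (EuclideanSpace ℝ (Fin 3))))
        - k (inner ℝ e (ω : (EuclideanSpace ℝ (Fin 3))))) ∂σ| ≤ ε * M := by
      rw [← Real.norm_eq_abs]
      exact norm_integral_le_of_norm_le_const
        (Filter.Eventually.of_forall fun ω => (hP _ (hmem ω)).le)
    have h2 : |∫ u in (-1 : ℝ)..1, (P.eval u - k u)| ≤ ε * 2 := by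
      rw [← Real.norm_eq_abs]
      have := intervalIntegral.norm_integral_le_of_norm_le_const (a := -1) (b := 1) (C := ε)
        (f := fun u => P.eval u - k u) (fun u hu => by
          rw [uIoc_of_le (by norm_num)] at hu
          exact (hP u ⟨hu.1.le, hu.2⟩).le)
      norm_num at this ⊢
      exact this
    rw [integral_sub (hint _ P.continuous) (hint _ hk), hpoly] at h1
    rw [intervalIntegral.integral_sub (P.continuous.intervalIntegrable _ _)
          (hk.intervalIntegrable _ _)] at h2
    rw [abs_le] at *
    have := pi_pos
    constructor <;> nlinarith
  by_contra hne
  have hpos := abs_pos.2 (sub_ne_zero.2 hne)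
  have hc : 0 < M + 4 * π := by positivity
  have := key (|∫ ω : Metric.sphere (0 : (EuclideanSpace ℝ (Fin 3))) 1, k (inner ℝ e (ω : (EuclideanSpace ℝ (Fin 3)))) ∂σ
      - 2 * π * ∫ u in (-1 : ℝ)..1, k u| / (2 * (M + 4 * π))) (by positivity)
  rw [div_mul_eq_mul_div, le_div_iff₀ (by positivity)] at this
  nlinarith

lemma PsiB_eq (p : (EuclideanSpace ℝ (Fin 3))) (η : ℝ) (x : (EuclideanSpace ℝ (Fin 3))) : PsiB p η x = max (η - ‖x - p‖) 0 := by
  unfold PsiB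
  split_ifs with h
  · rw [max_eq_left (by linarith)]
  · rw [max_eq_right (by linarith)]

lemma inner_int (η r s : ℝ) (hr : 0 < r) (hs : 0 < s)
    (h1 : |r - s| < η) (h2 : η < r + s) :
    ∫ u in (-1 : ℝ)..1, max (η - √(r ^ 2 + s ^ 2 + 2 * r * s * u)) 0
      = (1 / (r * s)) * (η ^ 3 / 6 - η * |r - s| ^ 2 / 2 + |r - s| ^ 3 / 3) := by
  have hle : |r - s| ≤ r + s := by linarith
  have hd := abs_nonneg (r - s)
  have hsub := intervalIntegral.integral_comp_mul_deriv (a := |r - s|) (b := r + s)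
    (f := fun ρ => (ρ ^ 2 - r ^ 2 - s ^ 2) / (2 * r * s)) (f' := fun ρ => ρ / (r * s))
    (g := fun u => max (η - √(r ^ 2 + s ^ 2 + 2 * r * s * u)) 0)
    (fun ρ _ => by
      have h := ((((hasDerivAt_id ρ).pow 2).sub_const (r ^ 2)).sub_const (s ^ 2)).div_const
        (2 * r * s)
      refine h.congr_deriv ?_
      norm_num
      field_simp)
    (by fun_prop) (by fun_prop)
  have e1 : (|r - s| ^ 2 - r ^ 2 - s ^ 2) / (2 * r * s) = -1 := by
    rw [sq_abs]; field_simp; ring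
  have e2 : ((r + s) ^ 2 - r ^ 2 - s ^ 2) / (2 * r * s) = 1 := by
    field_simp; ring
  rw [e1, e2] at hsub
  rw [← hsub]
  have hcongr : ∫ ρ in |r - s|..(r + s), ((fun u => max (η - √(r ^ 2 + s ^ 2 + 2 * r * s * u)) 0)
        ∘ fun ρ => (ρ ^ 2 - r ^ 2 - s ^ 2) / (2 * r * s)) ρ * (ρ / (r * s))
      = ∫ ρ in |r - s|..(r + s), max (η - ρ) 0 * (ρ / (r * s)) := by
    refine intervalIntegral.integral_congr fun ρ hρ => ?_
    rw [uIcc_of_le hle] at hρ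
    have : r ^ 2 + s ^ 2 + 2 * r * s * ((ρ ^ 2 - r ^ 2 - s ^ 2) / (2 * r * s)) = ρ ^ 2 := by
      field_simp; ring
    simp only [Function.comp]
    rw [this, sqrt_sq (by linarith [hρ.1])]
  rw [hcongr, ← intervalIntegral.integral_add_adjacent_intervals (b := η)
    (Continuous.intervalIntegrable (by fun_prop) _ _)
    (Continuous.intervalIntegrable (by fun_prop) _ _)]
  have i2 : ∫ ρ in η..(r + s), max (η - ρ) 0 * (ρ / (r * s)) = 0 := by
    rw [intervalIntegral.integral_congr (g := fun _ => (0:ℝ))]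
    · simp
    · intro ρ hρ
      rw [uIcc_of_le h2.le] at hρ
      simp only
      rw [max_eq_right (by linarith [hρ.1]), zero_mul]
  have i1 : ∫ ρ in |r - s|..η, max (η - ρ) 0 * (ρ / (r * s))
      = ∫ ρ in |r - s|..η, (1 / (r * s)) * (η * ρ - ρ ^ 2) := by
    refine intervalIntegral.integral_congr fun ρ hρ => ?_
    rw [uIcc_of_le h1.le] at hρ
    rw [max_eq_left (by linarith [hρ.2])]
    ring
  rw [i1, i2, intervalIntegral.integral_const_mul, intervalIntegral.integral_sub
    (Continuous.intervalIntegrable (by fun_prop) _ _)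
    (Continuous.intervalIntegrable (by fun_prop) _ _), intervalIntegral.integral_const_mul,
    integral_id, integral_pow]
  push_cast
  ring

lemma waveV_eq (p : (EuclideanSpace ℝ (Fin 3))) (η : ℝ) (x : (EuclideanSpace ℝ (Fin 3))) (s : ℝ) (hr : 0 < ‖x - p‖) (hs : 0 < s)
    (h1 : |‖x - p‖ - s| < η) (h2 : η < ‖x - p‖ + s) :
    waveV p η x s = (1 / (2 * ‖x - p‖)) *
      (η ^ 3 / 6 - η * |‖x - p‖ - s| ^ 2 / 2 + |‖x - p‖ - s| ^ 3 / 3) := by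
  set r := ‖x - p‖ with hrdef
  have he : ‖r⁻¹ • (x - p)‖ = 1 := by
    rw [norm_smul, ← hrdef, norm_inv, Real.norm_of_nonneg hr.le, inv_mul_cancel₀ hr.ne']
  have hpt : ∀ ω : Metric.sphere (0 : (EuclideanSpace ℝ (Fin 3))) 1, PsiB p η (x + s • (ω : (EuclideanSpace ℝ (Fin 3))))
      = (fun u => max (η - √(r ^ 2 + s ^ 2 + 2 * r * s * u)) 0)
        (inner ℝ (r⁻¹ • (x - p)) (ω : (EuclideanSpace ℝ (Fin 3)))) := by
    intro ω
    have hω : ‖(ω : (EuclideanSpace ℝ (Fin 3)))‖ = 1 := by simpa using ω.2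
    rw [PsiB_eq]
    simp only
    congr 2
    rw [← Real.sqrt_sq (norm_nonneg (x + s • (ω : (EuclideanSpace ℝ (Fin 3))) - p))]
    congr 1
    have hx : x + s • (ω : (EuclideanSpace ℝ (Fin 3))) - p = (x - p) + s • (ω : (EuclideanSpace ℝ (Fin 3))) := by abel
    rw [hx, norm_add_sq_real, ← hrdef, norm_smul, hω, inner_smul_right, inner_smul_left,
      Real.norm_of_nonneg hs.le]
    simp only [conj_trivial]
    field_simp
    ring
  unfold waveV
  have hI := sphere_cont _ he (fun u => max (η - √(r ^ 2 + s ^ 2 + 2 * r * s * u)) 0)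
    (by fun_prop)
  rw [integral_congr_ae (Filter.Eventually.of_forall hpt), hI, inner_int η r s hr hs h1 h2]
  field_simp
  ring

lemma hasDerivAt_abs_cube (y : ℝ) : HasDerivAt (fun y : ℝ => |y| ^ 3) (3 * y * |y|) y := by
  have h : (fun y : ℝ => |y| ^ 3) = fun y => y ^ 2 * |y| := by
    ext z; rw [pow_succ, sq_abs]
  rw [h]
  rcases eq_or_ne y 0 with rfl | hy
  · rw [hasDerivAt_iff_tendsto_slope_zero]
    have : Filter.Tendsto (fun t : ℝ => t * |t|) (nhdsWithin 0 {0}ᶜ) (nhds (0 * |0|)) :=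
      (Continuous.tendsto (by fun_prop) 0).mono_left nhdsWithin_le_nhds
    simp only [abs_zero, mul_zero] at this ⊢
    refine this.congr' ?_
    filter_upwards [self_mem_nhdsWithin] with t ht
    have : t ≠ 0 := ht
    simp
    field_simp
  · have := ((hasDerivAt_id y).pow 2).mul (hasDerivAt_abs hy)
    refine this.congr_deriv ?_
    rcases lt_or_gt_of_ne hy with h | h
    · simp [abs_of_neg h, sign_neg h]; ring
    · simp [abs_of_pos h, sign_pos h]; ring

/-- Proposition 3.1 (i), time derivative. -/
theorem stmt_3 (p : EuclideanSpace ℝ (Fin 3)) (η : ℝ) (hη : 0 < η)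
    (x : EuclideanSpace ℝ (Fin 3)) (t : ℝ) (ht : 0 < t)
    (h1 : |‖x - p‖ - t| < η) (h2 : η < ‖x - p‖ + t) :
    HasDerivAt (fun s => waveV p η x s)
      ((‖x - p‖ - t) / (2 * ‖x - p‖) * (η - |‖x - p‖ - t|)) t := by
  have hr : 0 < ‖x - p‖ := by
    rcases (norm_nonneg (x - p)).eq_or_lt with h | h
    · rw [← h, zero_sub, abs_neg, abs_of_pos ht] at h1
      rw [← h] at h2
      linarith
    · exact h
  have hd : HasDerivAt (fun s => ‖x - p‖ - s) (-1) t := by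
    simpa using (hasDerivAt_id t).const_sub ‖x - p‖
  have hc := (hasDerivAt_abs_cube (‖x - p‖ - t)).comp t hd
  have hmain := ((((hd.pow 2).const_mul η).div_const 2).const_sub (η ^ 3 / 6)).add
    (hc.div_const 3) |>.const_mul (1 / (2 * ‖x - p‖))
  refine (hmain.congr_of_eventuallyEq ?_).congr_deriv ?_
  · have n1 : ∀ᶠ s in nhds t, |‖x - p‖ - s| < η :=
      (Continuous.tendsto (f := fun s => |‖x - p‖ - s|) (by fun_prop) t).eventually_lt_const h1
    have n2 : ∀ᶠ s in nhds t, η < ‖x - p‖ + s :=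
      (Continuous.tendsto (f := fun s => ‖x - p‖ + s) (by fun_prop) t).eventually_const_lt h2
    filter_upwards [n1, n2, lt_mem_nhds ht] with s a b c
    rw [waveV_eq p η x s hr c a b]
    simp [sq_abs]
  · field_simp
    simp
    ring
end

section
/- (Proposition 3.1 (ii), value.) Let p ∈ ℝ³, η > 0, x ∈ ℝ³ with x ≠ p, and t ≥ 0 satisfy |x − p| + t < η. Then v(x,t) = η t − (1/(6|x − p|))·{ (|x − p| + t)³ − ||x − p| − t|³ }. -/
open MeasureTheory Real

open scoped ENNReal Pointwise

lemma aux_diff {s t : Set ℝ} {f : ℝ → ℝ≥0∞} (hs : MeasurableSet s) (ht : MeasurableSet t)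
    (hst : s ⊆ t) (h : ∀ x ∈ t \ s, f x = 0) : ∫⁻ x in t, f x = ∫⁻ x in s, f x := by
  rw [← lintegral_indicator hs, ← lintegral_indicator ht]
  refine lintegral_congr fun x => ?_
  by_cases hx : x ∈ s
  · simp [hx, hst hx]
  · by_cases hx' : x ∈ t
    · simp [hx, hx', h x ⟨hx', hx⟩]
    · simp [hx, hx']

lemma aux_ball2 (g : ℝ → ℝ≥0∞) (hg : Measurable g) :
    ∫⁻ q : ℝ × ℝ, g (√(q.1 ^ 2 + q.2 ^ 2)) =
      ENNReal.ofReal (2 * π) * ∫⁻ ρ in Set.Ioi (0:ℝ), ENNReal.ofReal ρ * g ρ := by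
  rw [← lintegral_comp_polarCoord_symm]
  have : ∀ p ∈ polarCoord.target, ENNReal.ofReal p.1 • (fun q : ℝ × ℝ => g (√(q.1 ^ 2 + q.2 ^ 2)))
      (polarCoord.symm p) = (ENNReal.ofReal p.1 * g p.1) * 1 := by
    rintro ⟨r, θ⟩ ⟨hr, hθ⟩
    have hr' : 0 < r := hr
    have : (r * cos θ) ^ 2 + (r * sin θ) ^ 2 = r ^ 2 := by
      nlinarith [sin_sq_add_cos_sq θ]
    simp [this, Real.sqrt_sq hr'.le]
  rw [setLIntegral_congr_fun polarCoord.open_target.measurableSet this, polarCoord_target,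
    Measure.volume_eq_prod, ← Measure.prod_restrict,
    lintegral_prod_mul (f := fun r => ENNReal.ofReal r * g r) (g := fun _ => 1)
      (by fun_prop) (by fun_prop), mul_comm]
  simp only [lintegral_const, Measure.restrict_apply MeasurableSet.univ, Set.univ_inter,
    Real.volume_Ioo, one_mul]
  congr 2
  ring

lemma aux_half (H f : ℝ → ℝ≥0∞) (hH : Measurable H) (hf : Measurable f) :
    ∫⁻ z : ℝ, ∫⁻ ρ in Set.Ioi (0:ℝ), ENNReal.ofReal ρ *
        (H (√(z ^ 2 + ρ ^ 2)) * f (z / √(z ^ 2 + ρ ^ 2))) =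
      (∫⁻ r in Set.Ioi (0:ℝ), ENNReal.ofReal (r ^ 2) * H r) *
        ∫⁻ s in Set.Ioo (-1:ℝ) 1, f s := by
  have h1 : ∫⁻ z : ℝ, ∫⁻ ρ in Set.Ioi (0:ℝ), ENNReal.ofReal ρ *
        (H (√(z ^ 2 + ρ ^ 2)) * f (z / √(z ^ 2 + ρ ^ 2))) =
      ∫⁻ q : ℝ × ℝ, ENNReal.ofReal q.2 *
        (H (√(q.1 ^ 2 + q.2 ^ 2)) * f (q.1 / √(q.1 ^ 2 + q.2 ^ 2))) := by
    rw [Measure.volume_eq_prod, lintegral_prod _ (by fun_prop)]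
    refine lintegral_congr fun z => ?_
    refine aux_diff (t := Set.univ) measurableSet_Ioi MeasurableSet.univ (Set.subset_univ _) ?_ |>.symm.trans ?_
    · rintro ρ ⟨-, hρ⟩
      have : ρ ≤ 0 := by simpa using hρ
      simp [ENNReal.ofReal_of_nonpos this]
    · simp
  rw [h1, ← lintegral_comp_polarCoord_symm]
  have : ∀ p ∈ polarCoord.target, ENNReal.ofReal p.1 • (fun q : ℝ × ℝ => ENNReal.ofReal q.2 *
        (H (√(q.1 ^ 2 + q.2 ^ 2)) * f (q.1 / √(q.1 ^ 2 + q.2 ^ 2))))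
      (polarCoord.symm p) = (ENNReal.ofReal (p.1 ^ 2) * H p.1) *
        (ENNReal.ofReal (sin p.2) * f (cos p.2)) := by
    rintro ⟨r, θ⟩ ⟨hr, hθ⟩
    have hr' : 0 < r := hr
    have : (r * cos θ) ^ 2 + (r * sin θ) ^ 2 = r ^ 2 := by
      nlinarith [sin_sq_add_cos_sq θ]
    simp only [polarCoord_symm_apply, this, Real.sqrt_sq hr'.le, smul_eq_mul]
    rw [mul_div_cancel_left₀ _ hr'.ne', ENNReal.ofReal_mul hr'.le, ENNReal.ofReal_pow hr'.le]
    ring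
  rw [setLIntegral_congr_fun polarCoord.open_target.measurableSet this, polarCoord_target,
    Measure.volume_eq_prod, ← Measure.prod_restrict,
    lintegral_prod_mul (f := fun r => ENNReal.ofReal (r ^ 2) * H r)
      (g := fun θ => ENNReal.ofReal (sin θ) * f (cos θ))
      (by fun_prop) (by fun_prop)]
  congr 1
  have himg : cos '' Set.Ioo 0 π = Set.Ioo (-1) 1 := by
    ext s
    constructor
    · rintro ⟨θ, ⟨h0, h1⟩, rfl⟩
      constructor
      · rw [← cos_pi]; exact strictAntiOn_cos ⟨h0.le, h1.le⟩ ⟨pi_pos.le, le_rfl⟩ h1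
      · rw [← cos_zero]; exact strictAntiOn_cos ⟨le_rfl, pi_pos.le⟩ ⟨h0.le, h1.le⟩ h0
    · rintro ⟨h0, h1⟩
      exact ⟨arccos s, ⟨arccos_pos.2 h1, lt_of_le_of_ne (arccos_le_pi s)
        (fun h => by rw [arccos_eq_pi] at h; linarith)⟩, cos_arccos h0.le h1.le⟩
  rw [← himg, lintegral_image_eq_lintegral_abs_deriv_mul measurableSet_Ioo
    (fun θ _ => (hasDerivAt_cos θ).hasDerivWithinAt)
    (injOn_cos.mono Set.Ioo_subset_Icc_self)]
  refine (aux_diff (s := Set.Ioo 0 π) measurableSet_Ioo measurableSet_Ioo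
    (Set.Ioo_subset_Ioo_left (by linarith [pi_pos])) ?_).trans ?_
  · rintro θ ⟨⟨h1, h2⟩, h3⟩
    have : θ ≤ 0 := by
      by_contra hh
      exact h3 ⟨not_le.1 hh, h2⟩
    simp [ENNReal.ofReal_of_nonpos (sin_nonpos_of_nonpos_of_neg_pi_le this h1.le)]
  · refine setLIntegral_congr_fun measurableSet_Ioo fun θ hθ => ?_
    simp only [abs_neg, abs_of_pos (sin_pos_of_mem_Ioo hθ)]

lemma aux_rad : ∫⁻ r in Set.Ioi (0:ℝ), ENNReal.ofReal (r ^ 2) * (Set.Ioo (0:ℝ) 1).indicator 1 r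
    = ENNReal.ofReal (1/3) := by
  have : ∀ r, ENNReal.ofReal (r ^ 2) * (Set.Ioo (0:ℝ) 1).indicator 1 r =
      (Set.Ioo (0:ℝ) 1).indicator (fun r => ENNReal.ofReal (r ^ 2)) r := by
    intro r
    by_cases h : r ∈ Set.Ioo (0:ℝ) 1 <;> simp [h]
  simp_rw [this]
  rw [setLIntegral_indicator measurableSet_Ioo, Set.inter_eq_left.2 (fun x hx => hx.1),
    ← ofReal_integral_eq_lintegral_ofReal]
  · rw [← integral_Ioc_eq_integral_Ioo, ← intervalIntegral.integral_of_le zero_le_one, integral_pow]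
    norm_num
  · exact ((continuous_pow 2).integrableOn_Icc (a := (0:ℝ)) (b := 1)).mono_set Set.Ioo_subset_Icc_self
  · exact Filter.Eventually.of_forall fun r => sq_nonneg r

lemma aux_vol (A : Set ℝ) (hA : MeasurableSet A) :
    volume {q : ℝ × ℝ × ℝ | √(q.1 ^ 2 + (q.2.1 ^ 2 + q.2.2 ^ 2)) ∈ Set.Ioo (0:ℝ) 1 ∧
      q.1 / √(q.1 ^ 2 + (q.2.1 ^ 2 + q.2.2 ^ 2)) ∈ A} =
    ENNReal.ofReal (2 * π) * (ENNReal.ofReal (1/3) * volume (A ∩ Set.Ioo (-1) 1)) := by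
  have hm : MeasurableSet {q : ℝ × ℝ × ℝ | √(q.1 ^ 2 + (q.2.1 ^ 2 + q.2.2 ^ 2)) ∈ Set.Ioo (0:ℝ) 1 ∧
      q.1 / √(q.1 ^ 2 + (q.2.1 ^ 2 + q.2.2 ^ 2)) ∈ A} := by
    apply MeasurableSet.inter
    · exact measurableSet_Ioo.preimage (by fun_prop)
    · exact hA.preimage (by fun_prop)
  have hI : Measurable ((Set.Ioo (0:ℝ) 1).indicator (1 : ℝ → ℝ≥0∞)) :=
    measurable_one.indicator measurableSet_Ioo
  have hJ : Measurable (A.indicator (1 : ℝ → ℝ≥0∞)) := measurable_one.indicator hA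
  have e1 : ∀ q : ℝ × ℝ × ℝ, Set.indicator {q : ℝ × ℝ × ℝ | √(q.1 ^ 2 + (q.2.1 ^ 2 + q.2.2 ^ 2)) ∈ Set.Ioo (0:ℝ) 1 ∧
      q.1 / √(q.1 ^ 2 + (q.2.1 ^ 2 + q.2.2 ^ 2)) ∈ A} (1 : ℝ × ℝ × ℝ → ℝ≥0∞) q =
      (fun ρ => (Set.Ioo (0:ℝ) 1).indicator (1 : ℝ → ℝ≥0∞) (√(q.1 ^ 2 + ρ ^ 2)) *
        A.indicator (1 : ℝ → ℝ≥0∞) (q.1 / √(q.1 ^ 2 + ρ ^ 2))) (√(q.2.1 ^ 2 + q.2.2 ^ 2)) := by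
    intro q
    simp only
    rw [Real.sq_sqrt (by positivity)]
    by_cases h1 : √(q.1 ^ 2 + (q.2.1 ^ 2 + q.2.2 ^ 2)) ∈ Set.Ioo (0:ℝ) 1
    · by_cases h2 : q.1 / √(q.1 ^ 2 + (q.2.1 ^ 2 + q.2.2 ^ 2)) ∈ A
      · rw [Set.indicator_of_mem h1, Set.indicator_of_mem h2, Set.indicator_of_mem (by exact ⟨h1, h2⟩)]
        simp
      · rw [Set.indicator_of_notMem h2, Set.indicator_of_notMem (fun h => h2 h.2), mul_zero]
    · rw [Set.indicator_of_notMem h1, Set.indicator_of_notMem (fun h => h1 h.1), zero_mul]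
  rw [← lintegral_indicator_one hm]
  simp_rw [e1]
  rw [Measure.volume_eq_prod, lintegral_prod _ (by fun_prop)]
  simp only
  have e2 : ∀ z : ℝ, ∫⁻ y : ℝ × ℝ, (fun ρ => (Set.Ioo (0:ℝ) 1).indicator (1 : ℝ → ℝ≥0∞) (√(z ^ 2 + ρ ^ 2)) *
        A.indicator (1 : ℝ → ℝ≥0∞) (z / √(z ^ 2 + ρ ^ 2))) (√(y.1 ^ 2 + y.2 ^ 2)) =
        ENNReal.ofReal (2 * π) * ∫⁻ ρ in Set.Ioi (0:ℝ), ENNReal.ofReal ρ *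
          ((Set.Ioo (0:ℝ) 1).indicator (1 : ℝ → ℝ≥0∞) (√(z ^ 2 + ρ ^ 2)) *
        A.indicator (1 : ℝ → ℝ≥0∞) (z / √(z ^ 2 + ρ ^ 2))) :=
    fun z => aux_ball2 (fun ρ => (Set.Ioo (0:ℝ) 1).indicator (1 : ℝ → ℝ≥0∞) (√(z ^ 2 + ρ ^ 2)) *
        A.indicator (1 : ℝ → ℝ≥0∞) (z / √(z ^ 2 + ρ ^ 2))) (by fun_prop)
  simp only at e2
  simp_rw [e2]
  rw [lintegral_const_mul' _ _ ENNReal.ofReal_ne_top, aux_half _ _ hI hJ, aux_rad,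
    lintegral_indicator_one hA, Measure.restrict_apply hA]

lemma aux_map (u : EuclideanSpace ℝ (Fin 3)) (hu : ‖u‖ = 1) :
    ((volume : Measure (EuclideanSpace ℝ (Fin 3))).toSphere).map
      (fun ω : Metric.sphere (0 : EuclideanSpace ℝ (Fin 3)) 1 =>
        inner ℝ u (ω : EuclideanSpace ℝ (Fin 3))) =
    ENNReal.ofReal (2 * π) • (volume.restrict (Set.Ioo (-1:ℝ) 1)) := by
  have hmeas : Measurable (fun ω : Metric.sphere (0 : EuclideanSpace ℝ (Fin 3)) 1 =>
        inner ℝ u (ω : EuclideanSpace ℝ (Fin 3))) := by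
    apply Continuous.measurable; fun_prop
  ext A hA
  rw [Measure.map_apply hmeas hA, Measure.toSphere_apply' _ (hA.preimage hmeas),
    Measure.smul_apply, Measure.restrict_apply hA]
  obtain ⟨b, hb⟩ := Orthonormal.exists_orthonormalBasis_extension_of_card_eq (𝕜 := ℝ)
    (E := EuclideanSpace ℝ (Fin 3)) (ι := Fin 3) (by simp) (v := fun _ => u) (s := {0}) (by
      refine ⟨fun i => by simpa using hu, fun i j hij => (hij (Subsingleton.elim _ _)).elim⟩)
  have hb0 : b 0 = u := hb 0 rfl
  have hT : MeasurePreserving (fun y : EuclideanSpace ℝ (Fin 3) =>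
      ((b.repr y 0, (b.repr y 1, b.repr y 2)) : ℝ × ℝ × ℝ)) := by
    have h3 := ((MeasurePreserving.id (volume : Measure ℝ)).prod (volume_preserving_finTwoArrow ℝ)).comp
      ((volume_preserving_piFinSuccAbove (fun _ : Fin 3 => ℝ) 0).comp
      ((PiLp.volume_preserving_ofLp (Fin 3)).comp b.measurePreserving_repr))
    exact h3
  have hset : Set.Ioo (0:ℝ) 1 • (Subtype.val '' ((fun ω : Metric.sphere (0 : EuclideanSpace ℝ (Fin 3)) 1 =>
        inner ℝ u (ω : EuclideanSpace ℝ (Fin 3))) ⁻¹' A)) =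
      (fun y : EuclideanSpace ℝ (Fin 3) =>
      ((b.repr y 0, (b.repr y 1, b.repr y 2)) : ℝ × ℝ × ℝ)) ⁻¹'
        {q : ℝ × ℝ × ℝ | √(q.1 ^ 2 + (q.2.1 ^ 2 + q.2.2 ^ 2)) ∈ Set.Ioo (0:ℝ) 1 ∧
      q.1 / √(q.1 ^ 2 + (q.2.1 ^ 2 + q.2.2 ^ 2)) ∈ A} := by
    have hn : ∀ y, √((b.repr y 0) ^ 2 + ((b.repr y 1) ^ 2 + (b.repr y 2) ^ 2)) = ‖y‖ := by
      intro y
      rw [← b.repr.norm_map y, EuclideanSpace.norm_eq, Fin.sum_univ_three]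
      simp [add_assoc]
    have hi : ∀ y, b.repr y 0 = inner ℝ u y := by
      intro y; rw [b.repr_apply_apply, hb0]
    ext y
    simp only [Set.mem_preimage, Set.mem_ofPred_eq, hn, Set.mem_smul, Set.mem_image]
    rw [hi]
    constructor
    · rintro ⟨r, hr, _, ⟨ω, hω, rfl⟩, rfl⟩
      have h1 : ‖r • (ω : EuclideanSpace ℝ (Fin 3))‖ = r := by
        rw [norm_smul, norm_eq_of_mem_sphere, mul_one, Real.norm_of_nonneg hr.1.le]
      rw [h1, inner_smul_right, mul_div_cancel_left₀ _ hr.1.ne']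
      exact ⟨hr, hω⟩
    · rintro ⟨hr, hA'⟩
      refine ⟨‖y‖, hr, ‖y‖⁻¹ • y, ⟨⟨‖y‖⁻¹ • y, ?_⟩, ?_, rfl⟩, ?_⟩
      · simp [norm_smul, hr.1.ne']
      · simp only [inner_smul_right]
        rwa [div_eq_inv_mul] at hA'
      · rw [smul_smul, mul_inv_cancel₀ hr.1.ne', one_smul]
  rw [hset, hT.measure_preimage, aux_vol A hA]
  · rw [smul_eq_mul, mul_left_comm, ← mul_assoc (_ : ℝ≥0∞) (ENNReal.ofReal (1/3))]
    have : ((Module.finrank ℝ (EuclideanSpace ℝ (Fin 3)) : ℕ) : ℝ≥0∞) * ENNReal.ofReal (1/3) = 1 := by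
      rw [← ENNReal.ofReal_natCast, ← ENNReal.ofReal_mul (by positivity)]
      simp
    rw [this, one_mul]
  · apply MeasurableSet.nullMeasurableSet
    apply MeasurableSet.inter
    · exact measurableSet_Ioo.preimage (by fun_prop)
    · exact hA.preimage (by fun_prop)

lemma aux_int_s4 (r t : ℝ) (hr : 0 < r) (ht : 0 < t) :
    ∫ s in (-1:ℝ)..1, √(r ^ 2 + 2 * r * t * s + t ^ 2) =
      1 / (3 * r * t) * ((r + t) ^ 3 - |r - t| ^ 3) := by
  have hrt : 0 < r * t := mul_pos hr ht
  have hF : ∀ s ∈ Set.Ioo (-1:ℝ) 1, HasDerivAt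
      (fun s => 1 / (3 * r * t) * (√(r ^ 2 + 2 * r * t * s + t ^ 2)) ^ 3)
      (√(r ^ 2 + 2 * r * t * s + t ^ 2)) s := by
    intro s hs
    have hpos : 0 < r ^ 2 + 2 * r * t * s + t ^ 2 := by
      nlinarith [sq_nonneg (r - t), hs.1, mul_pos hrt (by linarith [hs.1] : 0 < s + 1)]
    have h1 : HasDerivAt (fun s => r ^ 2 + 2 * r * t * s + t ^ 2) (2 * r * t) s := by
      simpa using (((hasDerivAt_id s).const_mul (2 * r * t)).const_add (r ^ 2)).add_const (t ^ 2)
    refine (((h1.sqrt hpos.ne').pow 3).const_mul (1 / (3 * r * t))).congr_deriv ?_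
    have hne := (Real.sqrt_pos.2 hpos).ne'
    generalize √(r ^ 2 + 2 * r * t * s + t ^ 2) = w at hne ⊢
    field_simp
    norm_num
  rw [intervalIntegral.integral_eq_sub_of_hasDerivAt_of_le (by norm_num) (by fun_prop) hF
    (Continuous.intervalIntegrable (by fun_prop) _ _)]
  have a1 : r ^ 2 + 2 * r * t * 1 + t ^ 2 = (r + t) ^ 2 := by ring
  have a2 : r ^ 2 + 2 * r * t * (-1) + t ^ 2 = (r - t) ^ 2 := by ring
  rw [a1, a2, Real.sqrt_sq (by positivity), Real.sqrt_sq_eq_abs]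
  ring

/-- Proposition 3.1 (ii), value. -/
theorem stmt_4 (p : EuclideanSpace ℝ (Fin 3)) (η : ℝ) (hη : 0 < η)
    (x : EuclideanSpace ℝ (Fin 3)) (hxp : x ≠ p) (t : ℝ) (ht : 0 ≤ t)
    (h : ‖x - p‖ + t < η) :
    waveV p η x t =
      η * t - (1 / (6 * ‖x - p‖)) *
        ((‖x - p‖ + t) ^ 3 - |‖x - p‖ - t| ^ 3) := by
  rcases ht.eq_or_lt with rfl | ht0
  · simp [waveV]
  have hr : 0 < ‖x - p‖ := norm_pos_iff.2 (sub_ne_zero.2 hxp)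
  set a := x - p with ha
  set u := ‖a‖⁻¹ • a with hu
  have hu1 : ‖u‖ = 1 := by simp [hu, norm_smul, hr.ne']
  have hau : a = ‖a‖ • u := by rw [hu, smul_smul, mul_inv_cancel₀ hr.ne', one_smul]
  have hPsi : ∀ ω : Metric.sphere (0 : EuclideanSpace ℝ (Fin 3)) 1,
      PsiB p η (x + t • (ω : EuclideanSpace ℝ (Fin 3))) =
      (fun s => η - √(‖a‖ ^ 2 + 2 * ‖a‖ * t * s + t ^ 2))
        (inner ℝ u (ω : EuclideanSpace ℝ (Fin 3))) := by
    intro ω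
    have e : x + t • (ω : EuclideanSpace ℝ (Fin 3)) - p = a + t • (ω : EuclideanSpace ℝ (Fin 3)) := by
      rw [ha]; abel
    have hto : ‖t • (ω : EuclideanSpace ℝ (Fin 3))‖ = t := by
      rw [norm_smul, norm_eq_of_mem_sphere, mul_one, Real.norm_of_nonneg ht]
    have hlt : ‖a + t • (ω : EuclideanSpace ℝ (Fin 3))‖ < η :=
      (norm_add_le _ _).trans_lt (by rw [hto]; exact h)
    have hsq : ‖a + t • (ω : EuclideanSpace ℝ (Fin 3))‖ ^ 2 =
        ‖a‖ ^ 2 + 2 * ‖a‖ * t * inner ℝ u (ω : EuclideanSpace ℝ (Fin 3)) + t ^ 2 := by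
      have hin : inner ℝ a (ω : EuclideanSpace ℝ (Fin 3)) =
          ‖a‖ * inner ℝ u (ω : EuclideanSpace ℝ (Fin 3)) := by
        conv_lhs => rw [hau, real_inner_smul_left]
      rw [norm_add_sq_real, hto, inner_smul_right, hin]
      ring
    simp only [PsiB, e, if_pos hlt]
    rw [← hsq, Real.sqrt_sq (norm_nonneg _)]
  have hmeas : Measurable (fun ω : Metric.sphere (0 : EuclideanSpace ℝ (Fin 3)) 1 =>
        inner ℝ u (ω : EuclideanSpace ℝ (Fin 3))) := by
    apply Continuous.measurable; fun_prop
  have hc : Continuous (fun s => η - √(‖a‖ ^ 2 + 2 * ‖a‖ * t * s + t ^ 2)) := by fun_prop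
  unfold waveV
  simp_rw [hPsi]
  rw [← integral_map (φ := fun ω : Metric.sphere (0 : EuclideanSpace ℝ (Fin 3)) 1 =>
        inner ℝ u (ω : EuclideanSpace ℝ (Fin 3))) hmeas.aemeasurable hc.aestronglyMeasurable,
    aux_map u hu1, integral_smul_measure, ← integral_Ioc_eq_integral_Ioo,
    ← intervalIntegral.integral_of_le (by norm_num), intervalIntegral.integral_sub
      (by simp) (Continuous.intervalIntegrable (by fun_prop) _ _), aux_int_s4 _ _ hr ht0,
    ENNReal.toReal_ofReal (by positivity)]
  simp only [intervalIntegral.integral_const, smul_eq_mul]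
  have := pi_pos.ne'
  field_simp
  ring
end

section
/- (Proposition A, j = −1.) Let η > 0, τ > 0, B = {y ∈ ℝ³ : |y| < η}, and x ∈ B with x ≠ 0. Then ∫_B e^{−τ|x−y|} / (|x−y| · |y|) dy = (4π/τ²)·( (1 − e^{−τ|x|})/|x| − e^{−τη} · sinh(τ|x|)/|x| ). -/
open MeasureTheory Real

lemma aux_radial (z : ℝ) (G : ℝ → ENNReal) :
    ∫⁻ ρ in Set.Ioi (0:ℝ), ENNReal.ofReal ρ * G (√(z^2+ρ^2))
      = ∫⁻ r in Set.Ioi |z|, ENNReal.ofReal r * G r := by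
  have him : (fun ρ : ℝ => √(z^2+ρ^2)) '' Set.Ioi 0 = Set.Ioi |z| := by
    ext r
    simp only [Set.mem_image, Set.mem_Ioi]
    constructor
    · rintro ⟨ρ, hρ, rfl⟩
      rw [← Real.sqrt_sq_eq_abs]
      exact Real.sqrt_lt_sqrt (sq_nonneg _) (by nlinarith)
    · intro h
      have h0 : 0 ≤ |z| := abs_nonneg z
      have h1 : z^2 < r^2 := by rw [← sq_abs z]; nlinarith
      refine ⟨√(r^2 - z^2), Real.sqrt_pos.2 (by linarith), ?_⟩
      rw [Real.sq_sqrt (by linarith), add_sub_cancel, Real.sqrt_sq (by linarith)]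
  rw [← him, lintegral_image_eq_lintegral_abs_deriv_mul (f' := fun ρ => ρ / √(z^2+ρ^2)) measurableSet_Ioi]
  · refine setLIntegral_congr_fun measurableSet_Ioi fun ρ hρ => ?_
    have hρ : 0 < ρ := hρ
    have hs : 0 < √(z^2+ρ^2) := Real.sqrt_pos.2 (by positivity)
    rw [← mul_assoc, ← ENNReal.ofReal_mul (abs_nonneg _), abs_of_pos (by positivity),
      div_mul_cancel₀ _ hs.ne']
  · intro ρ hρ
    have hρ : 0 < ρ := hρ
    have : HasDerivAt (fun ρ : ℝ => z^2+ρ^2) (2*ρ) ρ := by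
      simpa using (hasDerivAt_pow 2 ρ).const_add (z^2)
    have h2 := this.sqrt (by positivity)
    refine (h2.congr_deriv ?_).hasDerivWithinAt
    field_simp
  · intro u hu v hv h
    have hu : 0 < u := hu
    have hv : 0 < v := hv
    have h := (Real.sqrt_inj (by positivity) (by positivity)).1 h
    nlinarith

lemma aux_polar_s8 (H : ℝ → ENNReal) (hH : Measurable H) :
    ∫⁻ p : ℝ × ℝ, H (p.1^2+p.2^2)
      = ENNReal.ofReal (2*π) * ∫⁻ ρ in Set.Ioi (0:ℝ), ENNReal.ofReal ρ * H (ρ^2) := by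
  rw [← lintegral_comp_polarCoord_symm]
  have : ∀ p : ℝ × ℝ, ENNReal.ofReal p.1 • H ((polarCoord.symm p).1^2 + (polarCoord.symm p).2^2)
      = ENNReal.ofReal p.1 * H (p.1^2) := by
    intro p
    simp only [polarCoord_symm_apply, smul_eq_mul]
    congr 2
    nlinarith [Real.sin_sq_add_cos_sq p.2]
  simp_rw [this]
  rw [polarCoord_target, Measure.volume_eq_prod, setLIntegral_prod _ (by fun_prop)]
  simp only [lintegral_const, Measure.restrict_apply MeasurableSet.univ, Set.univ_inter, Real.volume_Ioo]
  rw [lintegral_mul_const _ (by fun_prop), mul_comm]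
  congr 2
  ring

lemma aux_E3 (F : ℝ → ℝ → ENNReal) (hF : Measurable (Function.uncurry F)) :
    ∫⁻ y : EuclideanSpace ℝ (Fin 3), F (y 0) ‖y‖
      = ∫⁻ r in Set.Ioi (0:ℝ), ∫⁻ z in Set.Ioo (-r) r, ENNReal.ofReal (2*π) * (ENNReal.ofReal r * F z r) := by
  have mp : MeasurePreserving (fun y : EuclideanSpace ℝ (Fin 3) => (y 0, (y 1, y 2))) :=
    (((MeasurePreserving.id volume).prod (volume_preserving_finTwoArrow ℝ)).comp
      (volume_preserving_piFinSuccAbove (fun _ : Fin 3 => ℝ) 0)).comp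
      (PiLp.volume_preserving_ofLp (Fin 3))
  have hF' : ∀ {α : Type} [MeasurableSpace α] {f g : α → ℝ}, Measurable f → Measurable g →
      Measurable fun x => F (f x) (g x) := fun hf hg => hF.comp (hf.prodMk hg)
  have e1 : ∫⁻ y : EuclideanSpace ℝ (Fin 3), F (y 0) ‖y‖
      = ∫⁻ q : ℝ × ℝ × ℝ, F q.1 (√(q.1^2 + (q.2.1^2+q.2.2^2))) := by
    rw [← mp.lintegral_comp (hF' (by fun_prop) (by fun_prop))]
    refine lintegral_congr fun y => ?_
    rw [EuclideanSpace.norm_eq, Fin.sum_univ_three]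
    simp [add_assoc]
  rw [e1, Measure.volume_eq_prod, lintegral_prod _ (hF' (by fun_prop) (by fun_prop)).aemeasurable]
  have e2 : ∀ z : ℝ, ∫⁻ p : ℝ × ℝ, F z (√(z^2 + (p.1^2+p.2^2)))
      = ∫⁻ r, (Set.Ioi |z|).indicator (fun r => ENNReal.ofReal (2*π) * (ENNReal.ofReal r * F z r)) r := by
    intro z
    rw [aux_polar_s8 (fun t => F z (√(z^2+t))) (hF' (by fun_prop) (by fun_prop)),
      aux_radial z (F z), lintegral_indicator measurableSet_Ioi, lintegral_const_mul]
    exact ENNReal.measurable_ofReal.mul (hF' measurable_const measurable_id)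
  simp_rw [e2]
  rw [lintegral_lintegral_swap, ← lintegral_indicator measurableSet_Ioi]
  · refine lintegral_congr fun r => ?_
    by_cases hr : 0 < r
    · rw [Set.indicator_of_mem (by exact hr), ← lintegral_indicator measurableSet_Ioo]
      refine lintegral_congr fun z => ?_
      by_cases hz : |z| < r
      · rw [Set.indicator_of_mem (by exact hz), Set.indicator_of_mem (by exact abs_lt.1 hz)]
      · rw [Set.indicator_of_notMem (by exact hz), Set.indicator_of_notMem]
        exact fun h => hz (abs_lt.2 h)
    · rw [Set.indicator_of_notMem (by exact hr)]
      rw [lintegral_eq_zero_of_ae_eq_zero]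
      refine Filter.Eventually.of_forall fun z => ?_
      refine Set.indicator_of_notMem ?_ _
      · exact fun h => hr (lt_of_le_of_lt (abs_nonneg z) h)
  · refine Measurable.aemeasurable ?_
    have hs : MeasurableSet {p : ℝ × ℝ | |p.1| < p.2} := measurableSet_lt (by fun_prop) (by fun_prop)
    have hm : Measurable fun p : ℝ × ℝ => ENNReal.ofReal (2*π) * (ENNReal.ofReal p.2 * F p.1 p.2) :=
      measurable_const.mul (Measurable.mul (by fun_prop) (hF' (by fun_prop) (by fun_prop)))
    exact hm.indicator hs

lemma aux_inner (τ a r : ℝ) (hτ : 0 < τ) (ha : 0 < a) (hr : 0 < r) :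
    ∫⁻ z in Set.Ioo (-r) r, ENNReal.ofReal (exp (-τ * √(r^2-2*a*z+a^2)) / √(r^2-2*a*z+a^2))
      = ENNReal.ofReal ((exp (-τ*|r-a|) - exp (-τ*(r+a)))/(τ*a)) := by
  have hle : |r - a| ≤ r + a := abs_le.2 ⟨by linarith, by linarith⟩
  have hab : 0 ≤ |r - a| := abs_nonneg _
  have him : (fun s : ℝ => (r^2+a^2-s^2)/(2*a)) '' Set.Ioo |r-a| (r+a) = Set.Ioo (-r) r := by
    ext z
    simp only [Set.mem_image, Set.mem_Ioo]
    constructor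
    · rintro ⟨s, ⟨h1, h2⟩, rfl⟩
      have h3 : (r-a)^2 < s^2 := by rw [← sq_abs (r-a)]; nlinarith
      rw [lt_div_iff₀ (by positivity), div_lt_iff₀ (by positivity)]
      constructor <;> nlinarith
    · rintro ⟨h1, h2⟩
      have h3 : (r-a)^2 < r^2-2*a*z+a^2 := by nlinarith
      refine ⟨√(r^2-2*a*z+a^2), ⟨?_, ?_⟩, ?_⟩
      · rw [← Real.sqrt_sq_eq_abs]; exact Real.sqrt_lt_sqrt (sq_nonneg _) h3
      · rw [Real.sqrt_lt' (by positivity)]; nlinarith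
      · rw [Real.sq_sqrt (by nlinarith [sq_nonneg (r-a)])]; field_simp; ring
  rw [← him, lintegral_image_eq_lintegral_abs_deriv_mul (f' := fun s => -s/a) measurableSet_Ioo]
  · have e : ∀ s ∈ Set.Ioo |r-a| (r+a), ENNReal.ofReal |(-s/a)| * ENNReal.ofReal
        (exp (-τ * √(r^2-2*a*((r^2+a^2-s^2)/(2*a))+a^2)) / √(r^2-2*a*((r^2+a^2-s^2)/(2*a))+a^2))
        = ENNReal.ofReal (exp (-τ*s)/a) := by
      intro s hs
      have hs0 : 0 < s := lt_of_le_of_lt hab hs.1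
      have : r^2-2*a*((r^2+a^2-s^2)/(2*a))+a^2 = s^2 := by field_simp; ring
      rw [this, Real.sqrt_sq hs0.le, ← ENNReal.ofReal_mul (abs_nonneg _), neg_div, abs_neg,
        abs_of_pos (by positivity)]
      congr 1
      field_simp
    rw [setLIntegral_congr_fun measurableSet_Ioo e, ← Measure.restrict_congr_set (Ioo_ae_eq_Ioc (μ := volume)).symm,
      ← ofReal_integral_eq_lintegral_ofReal, ← intervalIntegral.integral_of_le hle]
    · congr 1
      rw [intervalIntegral.integral_eq_sub_of_hasDerivAt (f := fun s => -exp (-τ*s)/(τ*a))]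
      · ring
      · intro s _
        have h : HasDerivAt (fun s => -τ*s) (-τ) s := by simpa using (hasDerivAt_id s).const_mul (-τ)
        refine (h.exp.neg.div_const (τ*a)).congr_deriv ?_
        field_simp
      · exact Continuous.intervalIntegrable (by fun_prop) _ _
    · exact (Continuous.integrableOn_Icc (by fun_prop)).mono_set Set.Ioc_subset_Icc_self
    · exact Filter.Eventually.of_forall fun s => by positivity
  · intro s _
    have h : HasDerivAt (fun s : ℝ => r^2+a^2-s^2) (-(2*s)) s := by
      simpa using (hasDerivAt_pow 2 s).const_sub (r^2+a^2)
    refine ((h.div_const (2*a)).congr_deriv ?_).hasDerivWithinAt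
    field_simp
  · intro u hu v hv h
    have hu0 : 0 < u := lt_of_le_of_lt hab hu.1
    have hv0 : 0 < v := lt_of_le_of_lt hab hv.1
    have h : (r^2+a^2-u^2)/(2*a) = (r^2+a^2-v^2)/(2*a) := h
    rw [div_left_inj' (by positivity)] at h
    nlinarith

lemma aux_outer (τ a η : ℝ) (hτ : 0 < τ) (ha : 0 < a) (hη : a < η) :
    ∫⁻ r in Set.Ioo 0 η, ENNReal.ofReal (2*π) * ENNReal.ofReal ((exp (-τ*|r-a|) - exp (-τ*(r+a)))/(τ*a))
      = ENNReal.ofReal ((4 * π / τ ^ 2) *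
        ((1 - exp (-τ * a)) / a - exp (-τ * η) * sinh (τ * a) / a)) := by
  simp_rw [← ENNReal.ofReal_mul (show 0 ≤ 2*π by positivity)]
  have hc : Continuous fun r : ℝ => 2*π*((exp (-τ*|r-a|) - exp (-τ*(r+a)))/(τ*a)) := by fun_prop
  rw [← Measure.restrict_congr_set (Ioo_ae_eq_Ioc (μ := volume)).symm,
      ← ofReal_integral_eq_lintegral_ofReal, ← intervalIntegral.integral_of_le (by linarith)]
  · congr 1
    rw [← intervalIntegral.integral_add_adjacent_intervals (b := a) (hc.intervalIntegrable _ _) (hc.intervalIntegrable _ _)]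
    have d1 : ∀ s, HasDerivAt (fun s => exp (-τ*(a-s))) (τ * exp (-τ*(a-s))) s := by
      intro s
      have h : HasDerivAt (fun s => -τ*(a-s)) τ s := by
        simpa using ((hasDerivAt_id s).const_sub a).const_mul (-τ)
      exact h.exp.congr_deriv (mul_comm _ _)
    have d2 : ∀ c s, HasDerivAt (fun s => exp (-τ*(s+c))) (-τ * exp (-τ*(s+c))) s := by
      intro c s
      have h : HasDerivAt (fun s => -τ*(s+c)) (-τ) s := by
        simpa using ((hasDerivAt_id s).add_const c).const_mul (-τ)
      exact h.exp.congr_deriv (mul_comm _ _)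
    have i1 : ∫ r in (0:ℝ)..a, 2*π*((exp (-τ*|r-a|) - exp (-τ*(r+a)))/(τ*a))
        = 2*π/(τ^2*a) * (exp (-τ*(a-a)) + exp (-τ*(a+a))) - 2*π/(τ^2*a)*(exp (-τ*(a-0)) + exp (-τ*(0+a))) := by
      rw [intervalIntegral.integral_congr (g := fun r => 2*π*((exp (-τ*(a-r)) - exp (-τ*(r+a)))/(τ*a)))]
      · rw [intervalIntegral.integral_eq_sub_of_hasDerivAt (f := fun r => 2*π/(τ^2*a) * (exp (-τ*(a-r)) + exp (-τ*(r+a))))]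
        · intro s _
          refine (((d1 s).add (d2 a s)).const_mul _).congr_deriv ?_
          field_simp
          ring
        · exact Continuous.intervalIntegrable (by fun_prop) _ _
      · intro r hr
        rw [Set.uIcc_of_le ha.le] at hr
        dsimp only
        rw [abs_of_nonpos (by linarith [hr.2]), neg_sub]
    have i2 : ∫ r in a..η, 2*π*((exp (-τ*|r-a|) - exp (-τ*(r+a)))/(τ*a))
        = 2*π/(τ^2*a) * (exp (-τ*(η+a)) - exp (-τ*(η+-a))) - 2*π/(τ^2*a)*(exp (-τ*(a+a)) - exp (-τ*(a+-a))) := by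
      rw [intervalIntegral.integral_congr (g := fun r => 2*π*((exp (-τ*(r+-a)) - exp (-τ*(r+a)))/(τ*a)))]
      · rw [intervalIntegral.integral_eq_sub_of_hasDerivAt (f := fun r => 2*π/(τ^2*a) * (exp (-τ*(r+a)) - exp (-τ*(r+-a))))]
        · intro s _
          refine (((d2 a s).sub (d2 (-a) s)).const_mul _).congr_deriv ?_
          field_simp
          ring
        · exact Continuous.intervalIntegrable (by fun_prop) _ _
      · intro r hr
        rw [Set.uIcc_of_le hη.le] at hr
        dsimp only
        rw [abs_of_nonneg (by linarith [hr.1]), sub_eq_add_neg r a]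
    rw [i1, i2, Real.sinh_eq]
    have e1 : exp (-τ*(η+a)) = exp (-τ*η) * exp (-(τ*a)) := by rw [← exp_add]; ring_nf
    have e2 : exp (-τ*(η+-a)) = exp (-τ*η) * exp (τ*a) := by rw [← exp_add]; ring_nf
    rw [e1, e2]
    simp only [sub_self, add_neg_cancel, mul_zero, exp_zero, sub_zero, zero_add]
    field_simp
    ring
  · exact (hc.integrableOn_Icc).mono_set Set.Ioc_subset_Icc_self
  · refine (ae_restrict_iff' measurableSet_Ioc).2 (Filter.Eventually.of_forall fun r hr => ?_)
    have : exp (-τ*(r+a)) ≤ exp (-τ*|r-a|) := by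
      rw [exp_le_exp]
      have : |r - a| ≤ r + a := abs_le.2 ⟨by linarith [hr.1], by linarith⟩
      nlinarith
    have h2 : 0 ≤ exp (-τ*|r-a|) - exp (-τ*(r+a)) := by linarith
    have := hr.1
    show (0:ℝ) ≤ _
    positivity

lemma aux_sinh (τ a η : ℝ) (hτ : 0 < τ) (ha : 0 < a) (hη : a < η) :
    0 ≤ (4 * π / τ ^ 2) *
        ((1 - exp (-τ * a)) / a - exp (-τ * η) * sinh (τ * a) / a) := by
  have h1 : exp (-τ*η) ≤ exp (-τ*a) := exp_le_exp.2 (by nlinarith)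
  have h2 : 0 ≤ sinh (τ*a) := Real.sinh_nonneg_iff.2 (by positivity)
  have h3 : exp (-τ*a) * sinh (τ*a) ≤ 1 - exp (-τ*a) := by
    rw [Real.sinh_eq, neg_mul]
    have : exp (-(τ*a)) * exp (τ*a) = 1 := by rw [← exp_add]; simp
    nlinarith [sq_nonneg (1 - exp (-(τ*a)))]
  rw [← sub_div]
  have : 0 ≤ 1 - exp (-τ * a) - exp (-τ * η) * sinh (τ * a) := by nlinarith
  positivity

lemma aux_rot_s8 (a : ℝ) (x : EuclideanSpace ℝ (Fin 3)) (hxa : ‖x‖ = a) (G : ℝ → ℝ → ENNReal) :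
    ∫⁻ y, G ‖x - y‖ ‖y‖ = ∫⁻ y : EuclideanSpace ℝ (Fin 3), G (√(‖y‖^2 - 2*a*(y 0) + a^2)) ‖y‖ := by
  set w : EuclideanSpace ℝ (Fin 3) := EuclideanSpace.single 0 a with hw
  have ha : 0 ≤ a := hxa ▸ norm_nonneg x
  have hn : ‖x‖ = ‖w‖ := by simp [hw, hxa, abs_of_nonneg ha]
  let R := Submodule.reflection (Submodule.span ℝ {w - x})ᗮ
  have hR : R w = x := Submodule.reflection_sub hn.symm
  rw [← (R.measurePreserving).lintegral_comp_emb R.toMeasurableEquiv.measurableEmbedding]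
  refine lintegral_congr fun y => ?_
  have h1 : ‖x - R y‖ = ‖y - w‖ := by
    rw [← hR, ← map_sub, R.norm_map, norm_sub_rev]
  have h2 : ‖y - w‖^2 = ‖y‖^2 - 2*a*(y 0) + a^2 := by
    rw [norm_sub_sq_real, ← hn, hxa, hw, real_inner_comm, EuclideanSpace.inner_single_left]
    simp
    ring
  rw [R.norm_map, h1, ← h2, Real.sqrt_sq (norm_nonneg _)]

/-- Proposition A, `j = −1`. -/
theorem stmt_8 (η τ : ℝ) (hη : 0 < η) (hτ : 0 < τ)
    (x : EuclideanSpace ℝ (Fin 3)) (hx : ‖x‖ < η) (hx0 : x ≠ 0) :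
    ∫ y in Metric.ball (0 : EuclideanSpace ℝ (Fin 3)) η,
        Real.exp (-τ * ‖x - y‖) / (‖x - y‖ * ‖y‖)
      = (4 * π / τ ^ 2) *
        ((1 - Real.exp (-τ * ‖x‖)) / ‖x‖
          - Real.exp (-τ * η) * Real.sinh (τ * ‖x‖) / ‖x‖) := by
  have ha : 0 < ‖x‖ := norm_pos_iff.2 hx0
  obtain ⟨a, hxa⟩ : ∃ a, ‖x‖ = a := ⟨_, rfl⟩
  have hm : Measurable fun y : EuclideanSpace ℝ (Fin 3) => exp (-τ * ‖x - y‖) / (‖x - y‖ * ‖y‖) := by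
    fun_prop
  rw [integral_eq_lintegral_of_nonneg_ae (Filter.Eventually.of_forall fun y => by positivity)
    hm.aestronglyMeasurable]
  rw [hxa] at hx ha
  rw [hxa, ← ENNReal.toReal_ofReal (aux_sinh τ a η hτ ha hx)]
  congr 1
  rw [← aux_outer τ a η hτ ha hx, ← lintegral_indicator Metric.isOpen_ball.measurableSet]
  have e1 : ∀ y, (Metric.ball (0 : EuclideanSpace ℝ (Fin 3)) η).indicator
      (fun y => ENNReal.ofReal (exp (-τ * ‖x - y‖) / (‖x - y‖ * ‖y‖))) y
      = (fun s r => (Set.Iio η).indicator (fun r => ENNReal.ofReal (exp (-τ * s) / (s * r))) r)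
        ‖x - y‖ ‖y‖ := by
    intro y
    simp only [Set.indicator, mem_ball_zero_iff, Set.mem_Iio]
  rw [lintegral_congr e1]
  refine (aux_rot_s8 a x hxa (fun s r => (Set.Iio η).indicator
    (fun r => ENNReal.ofReal (exp (-τ * s) / (s * r))) r)).trans ?_
  refine (aux_E3 (fun z r => (Set.Iio η).indicator
    (fun r => ENNReal.ofReal (exp (-τ * √(r^2-2*a*z+a^2)) / (√(r^2-2*a*z+a^2) * r))) r) ?_).trans ?_
  · have hs : MeasurableSet {p : ℝ × ℝ | p.2 < η} := measurableSet_lt (by fun_prop) (by fun_prop)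
    have hm : Measurable fun p : ℝ × ℝ => ENNReal.ofReal
      (exp (-τ * √(p.2^2-2*a*p.1+a^2)) / (√(p.2^2-2*a*p.1+a^2) * p.2)) := by fun_prop
    exact hm.indicator hs
  · rw [← lintegral_indicator measurableSet_Ioi, ← lintegral_indicator measurableSet_Ioo]
    refine lintegral_congr fun r => ?_
    by_cases hr : 0 < r
    · rw [Set.indicator_of_mem (by exact hr)]
      by_cases hr2 : r < η
      · rw [Set.indicator_of_mem (by exact ⟨hr, hr2⟩), ← aux_inner τ a r hτ ha hr,
          ← lintegral_const_mul _ (by fun_prop)]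
        refine lintegral_congr fun z => ?_
        rw [Set.indicator_of_mem (by exact hr2), ← ENNReal.ofReal_mul hr.le]
        congr 2
        rw [← div_div, mul_div_cancel₀ _ hr.ne']
      · rw [Set.indicator_of_notMem (by exact fun h => hr2 h.2)]
        simp [Set.indicator, hr2]
    · rw [Set.indicator_of_notMem (by exact hr), Set.indicator_of_notMem (by exact fun h => hr h.1)]
end

section
/- (Proposition A, j = 0.) Let η > 0, τ > 0, B = {y ∈ ℝ³ : |y| < η}, and x ∈ B with x ≠ 0. Then ∫_B e^{−τ|x−y|} / |x−y| dy = (4π/τ²)·( 1 − (η + 1/τ) e^{−τη} · sinh(τ|x|)/|x| ). -/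
open MeasureTheory Real

lemma L1 (τ b R : ℝ) (hτ : 0 < τ) (hb : b ≠ 0) (hR : 0 ≤ R) :
    ∫⁻ r in Set.Ioo 0 R, ENNReal.ofReal (r * (exp (-τ * √(b^2+r^2)) / √(b^2+r^2))) =
      ENNReal.ofReal ((exp (-τ * |b|) - exp (-τ * √(b^2+R^2))) / τ) := by
  have hpos : ∀ r : ℝ, 0 < b^2+r^2 := fun r => by positivity
  have hs : ∀ r : ℝ, √(b^2+r^2) ≠ 0 := fun r => (Real.sqrt_pos.2 (hpos r)).ne'
  have hcont : Continuous fun r : ℝ => r * (exp (-τ * √(b^2+r^2)) / √(b^2+r^2)) := by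
    refine continuous_id.mul (Continuous.div (by fun_prop) (by fun_prop) hs)
  have hd : ∀ r : ℝ, HasDerivAt (fun r => -(1/τ) * exp (-τ * √(b^2+r^2)))
      (r * (exp (-τ * √(b^2+r^2)) / √(b^2+r^2))) r := by
    intro r
    have h1 : HasDerivAt (fun r : ℝ => b^2+r^2) (2*r) r := by
      simpa using ((hasDerivAt_id r).pow 2).const_add (b^2)
    have h2 := (((h1.sqrt (hpos r).ne').const_mul (-τ)).exp).const_mul (-(1/τ))
    refine h2.congr_deriv ?_
    have := hs r
    field_simp
  have hI := intervalIntegral.integral_eq_sub_of_hasDerivAt (a := 0) (b := R)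
    (fun r _ => hd r) (hcont.intervalIntegrable _ _)
  rw [restrict_Ioo_eq_restrict_Ioc, ← ofReal_integral_eq_lintegral_ofReal,
    ← intervalIntegral.integral_of_le hR, hI]
  · congr 1
    have : √(b^2+0^2) = |b| := by simp [Real.sqrt_sq_eq_abs]
    simp only [this]
    field_simp
    ring
  · exact (hcont.intervalIntegrable 0 R).1
  · filter_upwards [ae_restrict_mem measurableSet_Ioc] with r hr
    have := hr.1.le
    show 0 ≤ _
    positivity

lemma L3a (τ a η : ℝ) (hτ : 0 < τ) (ha : 0 < a) (h : a < η) :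
    ∫ z in (-η)..η, exp (-τ * |a - z|) =
      2/τ - (exp (-τ*(η+a)) + exp (-τ*(η-a)))/τ := by
  have hc : Continuous fun z : ℝ => exp (-τ * |a - z|) := by fun_prop
  rw [← intervalIntegral.integral_add_adjacent_intervals (b := a)
    (hc.intervalIntegrable _ _) (hc.intervalIntegrable _ _)]
  have e1 : ∫ z in (-η)..a, exp (-τ * |a - z|) = ∫ z in (-η)..a, exp (-τ * (a - z)) := by
    apply intervalIntegral.integral_congr
    intro z hz
    rw [Set.uIcc_of_le (by linarith)] at hz
    simp only
    rw [abs_of_nonneg (by linarith [hz.2])]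
  have e2 : ∫ z in a..η, exp (-τ * |a - z|) = ∫ z in a..η, exp (-τ * (z - a)) := by
    apply intervalIntegral.integral_congr
    intro z hz
    rw [Set.uIcc_of_le (by linarith)] at hz
    simp only
    rw [abs_of_nonpos (by linarith [hz.1]), neg_sub]
  have d1 : ∀ z, HasDerivAt (fun z => (1/τ) * exp (-τ * (a - z))) (exp (-τ * (a - z))) z := by
    intro z
    refine HasDerivAt.congr_deriv (((((hasDerivAt_id z).const_sub a).const_mul (-τ)).exp).const_mul (1/τ)) ?_
    simp; field_simp
  have d2 : ∀ z, HasDerivAt (fun z => -(1/τ) * exp (-τ * (z - a))) (exp (-τ * (z - a))) z := by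
    intro z
    refine HasDerivAt.congr_deriv (((((hasDerivAt_id z).sub_const a).const_mul (-τ)).exp).const_mul (-(1/τ))) ?_
    simp; field_simp
  rw [e1, e2, intervalIntegral.integral_eq_sub_of_hasDerivAt (fun z _ => d1 z)
    (Continuous.intervalIntegrable (by fun_prop) _ _),
    intervalIntegral.integral_eq_sub_of_hasDerivAt (fun z _ => d2 z)
    (Continuous.intervalIntegrable (by fun_prop) _ _)]
  have : a - -η = η + a := by ring
  rw [this]
  simp
  field_simp
  ring

lemma L3b (τ a η : ℝ) (hτ : 0 < τ) (ha : 0 < a) (h : a < η) :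
    ∫ z in (-η)..η, exp (-τ * √(a^2+η^2-2*a*z)) =
      (1/a) * (((η-a)/τ+1/τ^2) * exp (-τ*(η-a)) - ((η+a)/τ+1/τ^2) * exp (-τ*(η+a))) := by
  have hc : Continuous fun z : ℝ => exp (-τ * √(a^2+η^2-2*a*z)) := by fun_prop
  have d : ∀ z ∈ Set.uIcc (-η) η, HasDerivAt
      (fun z => (1/a) * ((√(a^2+η^2-2*a*z)/τ+1/τ^2) * exp (-τ*√(a^2+η^2-2*a*z))))
      (exp (-τ * √(a^2+η^2-2*a*z))) z := by
    intro z hz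
    rw [Set.uIcc_of_le (by linarith)] at hz
    have hp : 0 < a^2+η^2-2*a*z := by nlinarith [hz.2, sq_nonneg (η - a), mul_pos ha (sub_pos.2 h), sq_pos_of_pos (sub_pos.2 h)]
    have h1 : HasDerivAt (fun z : ℝ => a^2+η^2-2*a*z) (-(2*a)) z := by
      simpa using ((hasDerivAt_id z).const_mul (2*a)).const_sub (a^2+η^2)
    have h2 := h1.sqrt hp.ne'
    have h3 := (((h2.div_const τ).add_const (1/τ^2)).mul ((h2.const_mul (-τ)).exp)).const_mul (1/a)
    refine h3.congr_deriv ?_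
    have := (Real.sqrt_pos.2 hp).ne'
    generalize √(a^2+η^2-2*a*z) = t at this ⊢
    field_simp
    ring
  rw [intervalIntegral.integral_eq_sub_of_hasDerivAt d (hc.intervalIntegrable _ _)]
  have s1 : √(a^2+η^2-2*a*η) = η - a := by
    rw [show a^2+η^2-2*a*η = (η-a)^2 by ring, Real.sqrt_sq (by linarith)]
  have s2 : √(a^2+η^2-2*a*(-η)) = η + a := by
    rw [show a^2+η^2-2*a*(-η) = (η+a)^2 by ring, Real.sqrt_sq (by linarith)]
  rw [s1, s2]; ring

lemma L2 (τ b c : ℝ) (hτ : 0 < τ) (hb : b ≠ 0) (hc : 0 < c) :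
    ∫⁻ p : ℝ × ℝ, (if p.1^2+p.2^2 < c then
      ENNReal.ofReal (exp (-τ * √(b^2+(p.1^2+p.2^2))) / √(b^2+(p.1^2+p.2^2))) else 0) =
      ENNReal.ofReal (2*π*((exp (-τ * |b|) - exp (-τ * √(b^2+c))) / τ)) := by
  rw [← lintegral_comp_polarCoord_symm]
  have hR := Real.sq_sqrt hc.le
  have hm : Measurable fun r : ℝ => (Set.Ioo 0 √c).indicator (fun r : ℝ => ENNReal.ofReal (r * (exp (-τ * √(b^2+r^2)) / √(b^2+r^2)))) r :=
    Measurable.indicator (by fun_prop) measurableSet_Ioo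
  have key : ∀ p ∈ polarCoord.target, ENNReal.ofReal p.1 • (if (polarCoord.symm p).1^2+(polarCoord.symm p).2^2 < c then
      ENNReal.ofReal (exp (-τ * √(b^2+((polarCoord.symm p).1^2+(polarCoord.symm p).2^2))) / √(b^2+((polarCoord.symm p).1^2+(polarCoord.symm p).2^2))) else 0)
      = (Set.Ioo 0 √c).indicator (fun r : ℝ => ENNReal.ofReal (r * (exp (-τ * √(b^2+r^2)) / √(b^2+r^2)))) p.1 * 1 := by
    rintro ⟨r, θ⟩ hp
    have hr : 0 < r := hp.1
    have e : (polarCoord.symm (r,θ)).1^2+(polarCoord.symm (r,θ)).2^2 = r^2 := by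
      simp only [polarCoord_symm_apply]
      linear_combination r^2 * Real.sin_sq_add_cos_sq θ
    rw [e]
    by_cases h : r^2 < c
    · have : r ∈ Set.Ioo 0 √c := ⟨hr, Real.lt_sqrt_of_sq_lt h⟩
      rw [if_pos h, Set.indicator_of_mem this, mul_one, ENNReal.ofReal_mul hr.le, smul_eq_mul]
    · have : r ∉ Set.Ioo 0 √c := fun hh => h ((Real.lt_sqrt hr.le).1 hh.2)
      rw [if_neg h, Set.indicator_of_notMem this]; simp
  rw [setLIntegral_congr_fun polarCoord.open_target.measurableSet key, polarCoord_target,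
    Measure.volume_eq_prod, ← Measure.prod_restrict,
    lintegral_prod_mul hm.aemeasurable aemeasurable_const, lintegral_indicator measurableSet_Ioo,
    Measure.restrict_restrict measurableSet_Ioo]
  have : Set.Ioo 0 √c ∩ Set.Ioi 0 = Set.Ioo 0 √c := by
    ext; simp; tauto
  rw [this, L1 τ b _ hτ hb (Real.sqrt_nonneg _), hR]
  have : ∫⁻ _ in Set.Ioo (-π) π, (1:ENNReal) = ENNReal.ofReal (2*π) := by
    rw [setLIntegral_one, Real.volume_Ioo]; congr 1; ring
  rw [this, mul_comm, ← ENNReal.ofReal_mul (by positivity)]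

noncomputable def val (τ a η : ℝ) : ℝ := 2*π/τ * ((2/τ - (exp (-τ*(η+a)) + exp (-τ*(η-a)))/τ) -
      (1/a) * (((η-a)/τ+1/τ^2) * exp (-τ*(η-a)) - ((η+a)/τ+1/τ^2) * exp (-τ*(η+a))))

lemma L4 (τ a η : ℝ) (hτ : 0 < τ) (ha : 0 < a) (h : a < η) :
    ∫⁻ q : ℝ × (ℝ × ℝ), (if q.1^2+(q.2.1^2+q.2.2^2) < η^2 then
      ENNReal.ofReal (exp (-τ * √((a-q.1)^2+(q.2.1^2+q.2.2^2))) / √((a-q.1)^2+(q.2.1^2+q.2.2^2))) else 0)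
      = ENNReal.ofReal (val τ a η) ∧ 0 ≤ val τ a η := by
  have hη : 0 < η := by linarith
  have hI : ∫ z in (-η)..η, 2*π*((exp (-τ * |a-z|) - exp (-τ * √(a^2+η^2-2*a*z))) / τ) = val τ a η := by
    rw [intervalIntegral.integral_const_mul, intervalIntegral.integral_div, intervalIntegral.integral_sub, L3a τ a η hτ ha h, L3b τ a η hτ ha h, val]
    · ring
    · exact Continuous.intervalIntegrable (by fun_prop) _ _
    · exact Continuous.intervalIntegrable (by fun_prop) _ _
  have hnn : ∀ z ∈ Set.Ioc (-η) η, 0 ≤ 2*π*((exp (-τ * |a-z|) - exp (-τ * √(a^2+η^2-2*a*z))) / τ) := by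
    intro z hz
    have : |a-z| ≤ √(a^2+η^2-2*a*z) := by
      apply Real.abs_le_sqrt
      nlinarith [hz.1, hz.2]
    have : exp (-τ * √(a^2+η^2-2*a*z)) ≤ exp (-τ * |a-z|) := by
      apply Real.exp_le_exp.2; nlinarith
    have := sub_nonneg.2 this
    positivity
  constructor
  swap
  · rw [← hI]
    apply intervalIntegral.integral_nonneg_of_ae_restrict (by linarith)
    rw [← restrict_Ioc_eq_restrict_Icc]
    filter_upwards [ae_restrict_mem measurableSet_Ioc] with z hz using hnn z hz
  rw [Measure.volume_eq_prod, lintegral_prod]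
  swap
  · apply Measurable.aemeasurable
    apply Measurable.ite (measurableSet_lt (by fun_prop) (by fun_prop)) (by fun_prop) (by fun_prop)
  have key : ∀ᵐ z : ℝ, (∫⁻ p : ℝ × ℝ, (if z^2+(p.1^2+p.2^2) < η^2 then
      ENNReal.ofReal (exp (-τ * √((a-z)^2+(p.1^2+p.2^2))) / √((a-z)^2+(p.1^2+p.2^2))) else 0))
      = (Set.Ioo (-η) η).indicator (fun z => ENNReal.ofReal (2*π*((exp (-τ * |a-z|) - exp (-τ * √(a^2+η^2-2*a*z))) / τ))) z := by
    filter_upwards [Measure.ae_ne volume a] with z hz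
    by_cases hz' : z ∈ Set.Ioo (-η) η
    · rw [Set.indicator_of_mem hz']
      have := L2 τ (a-z) (η^2-z^2) hτ (sub_ne_zero.2 hz.symm) (by nlinarith [hz'.1, hz'.2])
      rw [show (a-z)^2+(η^2-z^2) = a^2+η^2-2*a*z by ring] at this
      rw [← this]
      simp only [lt_sub_iff_add_lt']
    · rw [Set.indicator_of_notMem hz']
      have : η^2 ≤ z^2 := by
        by_contra hh
        exact hz' (abs_lt.1 (abs_lt_of_sq_lt_sq (not_le.1 hh) hη.le))
      have h2 : ∀ p : ℝ × ℝ, ¬ (z^2+(p.1^2+p.2^2) < η^2) := fun p => by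
        nlinarith [sq_nonneg p.1, sq_nonneg p.2]
      simp [h2]
  rw [lintegral_congr_ae key, lintegral_indicator measurableSet_Ioo, restrict_Ioo_eq_restrict_Ioc,
    ← ofReal_integral_eq_lintegral_ofReal, ← intervalIntegral.integral_of_le (by linarith), hI]
  · exact (Continuous.intervalIntegrable (by fun_prop) (-η) η).1
  · filter_upwards [ae_restrict_mem measurableSet_Ioc] with z hz using hnn z hz

lemma L5 (τ a η : ℝ) (hτ : 0 < τ) (ha : 0 < a) :
    val τ a η = (4 * π / τ ^ 2) *
        (1 - (η + 1 / τ) * Real.exp (-τ * η) * Real.sinh (τ * a) / a) := by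
  rw [val, Real.sinh_eq, show -τ*(η+a) = -τ*η + -(τ*a) by ring, show -τ*(η-a) = -τ*η + τ*a by ring,
    Real.exp_add, Real.exp_add]
  field_simp
  ring

lemma L6 (F : EuclideanSpace ℝ (Fin 3) → ENNReal) :
    ∫⁻ y, F y = ∫⁻ q : ℝ × (ℝ × ℝ), F (!₂[q.1, q.2.1, q.2.2]) := by
  rw [← (PiLp.volume_preserving_toLp (Fin 3)).lintegral_comp_emb (MeasurableEquiv.toLp 2 _).measurableEmbedding,
    ← (volume_preserving_piFinSuccAbove (fun _ : Fin 3 => ℝ) 0).symm.lintegral_comp_emb (MeasurableEquiv.measurableEmbedding _),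
    ← (show MeasurePreserving (Prod.map id MeasurableEquiv.finTwoArrow.symm) (volume : Measure (ℝ × (ℝ × ℝ))) (volume : Measure (ℝ × (Fin 2 → ℝ))) from
        (MeasurePreserving.id volume).prod (volume_preserving_finTwoArrow ℝ).symm).lintegral_comp_emb
      ((MeasurableEquiv.refl ℝ).prodCongr MeasurableEquiv.finTwoArrow.symm).measurableEmbedding]
  apply lintegral_congr
  intro q
  congr 2
  ext i
  fin_cases i <;> rfl

theorem stmt_9 (η τ : ℝ) (hη : 0 < η) (hτ : 0 < τ)
    (x : EuclideanSpace ℝ (Fin 3)) (hx : ‖x‖ < η) (hx0 : x ≠ 0) :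
    ∫ y in Metric.ball (0 : EuclideanSpace ℝ (Fin 3)) η,
        Real.exp (-τ * ‖x - y‖) / ‖x - y‖
      = (4 * π / τ ^ 2) *
        (1 - (η + 1 / τ) * Real.exp (-τ * η) * Real.sinh (τ * ‖x‖) / ‖x‖) := by
  have ha : 0 < ‖x‖ := norm_pos_iff.2 hx0
  obtain ⟨h4, h4'⟩ := L4 τ ‖x‖ η hτ ha hx
  rw [← L5 τ ‖x‖ η hτ ha, integral_eq_lintegral_of_nonneg_ae]
  rotate_left
  · exact Filter.Eventually.of_forall fun y => by
      show 0 ≤ _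
      positivity
  · apply Measurable.aestronglyMeasurable
    fun_prop
  rw [← ENNReal.toReal_ofReal h4', ← h4]
  congr 1
  set w : EuclideanSpace ℝ (Fin 3) := !₂[‖x‖, 0, 0] with hw
  have hwn : ‖x‖ = ‖w‖ := by
    rw [EuclideanSpace.norm_eq w]
    simp [hw, Fin.sum_univ_three]
  let T := (ℝ ∙ (x - w))ᗮ.reflection
  have hT : T x = w := Submodule.reflection_sub hwn
  rw [← lintegral_indicator Metric.isOpen_ball.measurableSet,
    ← T.symm.measurePreserving.lintegral_comp_emb T.symm.toHomeomorph.measurableEmbedding, L6]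
  apply lintegral_congr
  rintro ⟨z, p, q⟩
  have n1 : ∀ y, ‖x - T.symm y‖ = ‖w - y‖ := fun y => by
    rw [← hT, ← T.norm_map (x - T.symm y)]; simp
  have n2 : ‖w - !₂[z, p, q]‖ = √((‖x‖-z)^2+(p^2+q^2)) := by
    rw [EuclideanSpace.norm_eq]
    simp [hw, Fin.sum_univ_three, add_assoc]
  have n3 : ‖(!₂[z, p, q] : EuclideanSpace ℝ (Fin 3))‖ = √(z^2+(p^2+q^2)) := by
    rw [EuclideanSpace.norm_eq]
    simp [Fin.sum_univ_three, add_assoc]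
  have m : T.symm !₂[z, p, q] ∈ Metric.ball (0 : EuclideanSpace ℝ (Fin 3)) η ↔ z^2+(p^2+q^2) < η^2 := by
    rw [mem_ball_zero_iff, T.symm.norm_map, n3, Real.sqrt_lt' hη]
  by_cases hm : z^2+(p^2+q^2) < η^2
  · rw [Set.indicator_of_mem (m.2 hm), n1, n2, if_pos hm]
  · rw [Set.indicator_of_notMem (fun h => hm (m.1 h)), if_neg hm]
end

section
/- (Formula (3.4), j = −1.) Let p ∈ ℝ³, 0 < R₁ < R₂, τ > 0, and x ∈ ℝ³ with 0 < |x − p| < R₁. Then (1/(4π)) ∫_{{y : R₁ < |y−p| < R₂}} e^{−τ|x−y|} / (|x−y| · |y−p|) dy = (1/τ²)·( e^{−τR₁} − e^{−τR₂} )·sinh(τ|x − p|)/|x − p|. -/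
open MeasureTheory Real

lemma integrable_of_bdd_supp {α : Type*} [MeasurableSpace α] {μ : Measure α} {f : α → ℝ}
    (hf : Measurable f) (C : ℝ) (hC : ∀ a, |f a| ≤ C) (s : Set α) (hs : μ s ≠ ⊤)
    (h0 : ∀ a, a ∉ s → f a = 0) : Integrable f μ := by
  rw [← integrableOn_iff_integrable_of_support_subset (s := s)]
  · exact Measure.integrableOn_of_bounded hs hf.aestronglyMeasurable (M := C)
      (Filter.Eventually.of_forall hC)
  · intro a ha
    by_contra h
    exact ha (h0 a h)

lemma integral_split (G : ℝ → ℝ → ℝ) :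
    ∫ w : EuclideanSpace ℝ (Fin 3), G (w 0) (√(w 1 ^ 2 + w 2 ^ 2)) =
      ∫ q : ℝ × EuclideanSpace ℝ (Fin 2), G q.1 ‖q.2‖ := by
  have h1 := (EuclideanSpace.volume_preserving_symm_measurableEquiv_toLp (Fin 3)).integral_comp'
    (fun w : Fin 3 → ℝ => G (w 0) (√(w 1 ^ 2 + w 2 ^ 2)))
  have h2 := (volume_preserving_piFinSuccAbove (fun _ : Fin 3 => ℝ) 0).integral_comp'
    (fun q : ℝ × (Fin 2 → ℝ) => G q.1 (√(q.2 0 ^ 2 + q.2 1 ^ 2)))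
  have h3 := ((MeasurePreserving.id (volume : Measure ℝ)).prod
    (EuclideanSpace.volume_preserving_symm_measurableEquiv_toLp (Fin 2))).integral_comp
    (MeasurableEquiv.measurableEmbedding
      ((MeasurableEquiv.refl ℝ).prodCongr (MeasurableEquiv.toLp 2 (Fin 2 → ℝ)).symm))
    (fun q : ℝ × (Fin 2 → ℝ) => G q.1 (√(q.2 0 ^ 2 + q.2 1 ^ 2)))
  refine Eq.trans h1 (Eq.trans h2 (Eq.trans h3.symm ?_))
  refine integral_congr_ae (Filter.Eventually.of_forall fun q => ?_)
  simp [EuclideanSpace.norm_eq, Fin.sum_univ_two]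

lemma integral_axial (G : ℝ → ℝ → ℝ) (hG : Measurable (fun q : ℝ × ℝ => G q.1 q.2))
    (C R : ℝ) (hR : 0 < R) (hC : ∀ u ρ, |G u ρ| ≤ C)
    (h0 : ∀ u ρ, R ^ 2 ≤ u ^ 2 + ρ ^ 2 → G u ρ = 0) :
    ∫ w : EuclideanSpace ℝ (Fin 3), G (w 0) (√(w 1 ^ 2 + w 2 ^ 2)) =
      2 * π * ∫ r in Set.Ioi (0:ℝ), ∫ θ in Set.Ioo 0 π,
        r ^ 2 * sin θ * G (r * cos θ) (r * sin θ) := by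
  have hC0 : 0 ≤ C := (abs_nonneg _).trans (hC 0 0)
  rw [integral_split]
  have hint1 : Integrable (fun q : ℝ × EuclideanSpace ℝ (Fin 2) => G q.1 ‖q.2‖)
      (volume.prod volume) := by
    refine integrable_of_bdd_supp ?_ C (fun a => hC _ _) (Metric.closedBall 0 R) ?_ ?_
    · exact hG.comp (measurable_fst.prodMk measurable_snd.norm)
    · exact measure_closedBall_lt_top.ne
    · intro q hq
      apply h0
      simp only [Metric.mem_closedBall, dist_zero_right, Prod.norm_def, not_le, lt_sup_iff,
        Real.norm_eq_abs] at hq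
      rcases hq with h | h
      · nlinarith [sq_abs q.1, sq_nonneg ‖q.2‖]
      · nlinarith [sq_nonneg q.1]
  let H : ℝ × ℝ → ℝ := fun q => if 0 < q.2 then q.2 * G q.1 q.2 else 0
  have hHm : Measurable H := by
    refine Measurable.ite (measurableSet_lt measurable_const measurable_snd)
      (measurable_snd.mul hG) measurable_const
  have hHb : ∀ q, |H q| ≤ R * C := by
    intro q
    by_cases hq : 0 < q.2
    · simp only [H, hq, if_true, abs_mul]
      by_cases hq2 : q.2 ≤ R
      · rw [abs_of_pos hq]
        exact mul_le_mul hq2 (hC _ _) (abs_nonneg _) hR.le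
      · rw [h0 _ _ (by nlinarith [sq_nonneg q.1])]
        simp; positivity
    · simp only [H, hq, if_false, abs_zero]; positivity
  have hH0 : ∀ q : ℝ × ℝ, R ^ 2 ≤ q.1 ^ 2 + q.2 ^ 2 → H q = 0 := by
    intro q hq
    simp [H, h0 _ _ hq]
  have hint2 : Integrable H (volume.prod volume) := by
    refine integrable_of_bdd_supp hHm _ hHb (Metric.closedBall 0 R)
      measure_closedBall_lt_top.ne ?_
    intro q hq
    apply hH0
    simp only [Metric.mem_closedBall, dist_zero_right, Prod.norm_def, not_le, lt_sup_iff,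
        Real.norm_eq_abs] at hq
    rcases hq with h | h
    · nlinarith [sq_abs q.1, sq_nonneg q.2]
    · nlinarith [sq_abs q.2, sq_nonneg q.1]
  have e1 : ∫ q : ℝ × EuclideanSpace ℝ (Fin 2), G q.1 ‖q.2‖ = 2 * π * ∫ q, H q := by
    rw [Measure.volume_eq_prod, integral_prod _ hint1, Measure.volume_eq_prod,
      integral_prod _ hint2, ← integral_const_mul]
    congr 1
    ext u
    rw [integral_fun_norm_addHaar volume (fun ρ => G u ρ)]
    have : (volume : Measure (EuclideanSpace ℝ (Fin 2))).real (Metric.ball 0 1) = π := by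
      simp [Measure.real, pi_pos.le]
    rw [this, ← integral_indicator measurableSet_Ioi]
    simp only [finrank_euclideanSpace, Fintype.card_fin, smul_eq_mul, nsmul_eq_mul]
    rw [← mul_assoc]
    congr 2
    ext ρ
    simp [H, Set.indicator_apply]
  rw [e1, ← integral_comp_polarCoord_symm]
  congr 1
  rw [polarCoord_target, Measure.volume_eq_prod, setIntegral_prod]
  · refine setIntegral_congr_fun measurableSet_Ioi fun r hr => ?_
    have hr : 0 < r := hr
    simp only [polarCoord_symm_apply, smul_eq_mul]
    have hsub : Set.Ioo 0 π ⊆ Set.Ioo (-π) π := Set.Ioo_subset_Ioo_left (by linarith [pi_pos])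
    rw [setIntegral_eq_of_subset_of_forall_sdiff_eq_zero measurableSet_Ioo hsub]
    · refine setIntegral_congr_fun measurableSet_Ioo fun θ hθ => ?_
      have := sin_pos_of_pos_of_lt_pi hθ.1 hθ.2
      have h2 : 0 < r * sin θ := by positivity
      simp only [H, h2, if_true]
      ring
    · intro θ hθ
      have h1 : θ ≤ 0 := by
        by_contra h
        exact hθ.2 ⟨not_le.1 h, hθ.1.2⟩
      have : sin θ ≤ 0 := sin_nonpos_of_nonpos_of_neg_pi_le h1 hθ.1.1.le
      have h2 : ¬ (0 < r * sin θ) := by nlinarith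
      simp only [H, h2, if_false, mul_zero]
  · rw [← integrable_indicator_iff (measurableSet_Ioi.prod measurableSet_Ioo)]
    refine integrable_of_bdd_supp (C := R * (R * C)) (s := Set.Ioo 0 R ×ˢ Set.Ioo (-π) π) ?_ ?_ ?_ ?_
    · refine Measurable.indicator ?_ (measurableSet_Ioi.prod measurableSet_Ioo)
      refine measurable_fst.mul (hHm.comp ?_)
      exact continuous_polarCoord_symm.measurable
    · intro q
      by_cases hq : q ∈ Set.Ioi (0:ℝ) ×ˢ Set.Ioo (-π) π
      · rw [Set.indicator_of_mem hq]
        have hq1 : 0 < q.1 := hq.1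
        by_cases hqR : q.1 ≤ R
        · rw [smul_eq_mul, abs_mul, abs_of_pos hq1]
          exact mul_le_mul hqR (hHb _) (abs_nonneg _) hR.le
        · rw [hH0]
          · simp; positivity
          · simp only [polarCoord_symm_apply]
            rw [show (q.1 * cos q.2) ^ 2 + (q.1 * sin q.2) ^ 2 = q.1 ^ 2 * (sin q.2 ^ 2 + cos q.2 ^ 2) by
              ring, sin_sq_add_cos_sq]
            nlinarith
      · rw [Set.indicator_of_notMem hq]; simp; positivity
    · rw [Measure.prod_prod]
      simp [ENNReal.mul_eq_top]
    · intro q hq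
      by_cases hq' : q ∈ Set.Ioi (0:ℝ) ×ˢ Set.Ioo (-π) π
      · rw [Set.indicator_of_mem hq']
        have hqR : R ≤ q.1 := by
          by_contra h
          exact hq ⟨⟨hq'.1, not_le.1 h⟩, hq'.2⟩
        rw [hH0, smul_zero]
        simp only [polarCoord_symm_apply]
        rw [show (q.1 * cos q.2) ^ 2 + (q.1 * sin q.2) ^ 2 = q.1 ^ 2 * (sin q.2 ^ 2 + cos q.2 ^ 2) by
          ring, sin_sq_add_cos_sq]
        nlinarith
      · rw [Set.indicator_of_notMem hq']

lemma inner_theta (r d τ : ℝ) (hd : 0 < d) (hr : d < r) (hτ : 0 < τ) :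
    ∫ θ in Set.Ioo 0 π, sin θ * (exp (-τ * √((r * cos θ - d) ^ 2 + (r * sin θ) ^ 2)) /
      √((r * cos θ - d) ^ 2 + (r * sin θ) ^ 2)) =
      2 * exp (-τ * r) * sinh (τ * d) / (τ * r * d) := by
  have hr0 : 0 < r := hd.trans hr
  rw [← integral_Ioc_eq_integral_Ioo, ← intervalIntegral.integral_of_le pi_pos.le]
  have hpos : ∀ θ, 0 < (r * cos θ - d) ^ 2 + (r * sin θ) ^ 2 := by
    intro θ
    rw [show (r * cos θ - d) ^ 2 + (r * sin θ) ^ 2 = r ^ 2 * (sin θ ^ 2 + cos θ ^ 2)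
      - 2 * (r * d) * cos θ + d ^ 2 by ring, sin_sq_add_cos_sq]
    nlinarith [mul_le_mul_of_nonneg_left (cos_le_one θ) (mul_pos hr0 hd).le,
      pow_pos (sub_pos.2 hr) 2]
  rw [intervalIntegral.integral_eq_sub_of_hasDerivAt
    (f := fun θ => -exp (-τ * √((r * cos θ - d) ^ 2 + (r * sin θ) ^ 2)) / (τ * r * d))]
  · have a1 : √((r * cos π - d) ^ 2 + (r * sin π) ^ 2) = r + d := by
      rw [cos_pi, sin_pi, show (r * -1 - d) ^ 2 + (r * 0) ^ 2 = (r + d) ^ 2 by ring]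
      exact sqrt_sq (by linarith)
    have a2 : √((r * cos 0 - d) ^ 2 + (r * sin 0) ^ 2) = r - d := by
      rw [cos_zero, sin_zero, show (r * 1 - d) ^ 2 + (r * 0) ^ 2 = (r - d) ^ 2 by ring]
      exact sqrt_sq (by linarith)
    simp only [a1, a2]
    rw [sinh_eq, show -τ * (r + d) = -τ * r + -(τ * d) by ring,
      show -τ * (r - d) = -τ * r + τ * d by ring, exp_add, exp_add]
    ring
  · intro θ _
    have h1 : HasDerivAt (fun θ => (r * cos θ - d) ^ 2 + (r * sin θ) ^ 2)
        (2 * r * d * sin θ) θ := by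
      have := ((((hasDerivAt_cos θ).const_mul r).sub_const d).pow 2).add
        (((hasDerivAt_sin θ).const_mul r).pow 2)
      refine HasDerivAt.congr_deriv this ?_
      simp; ring
    have h2 := ((((h1.sqrt (hpos θ).ne').const_mul (-τ)).exp).neg).div_const (τ * r * d)
    refine HasDerivAt.congr_deriv h2 ?_
    have := sqrt_pos.2 (hpos θ)
    field_simp
  · apply Continuous.intervalIntegrable
    have : ∀ θ, √((r * cos θ - d) ^ 2 + (r * sin θ) ^ 2) ≠ 0 := fun θ => (sqrt_pos.2 (hpos θ)).ne'
    fun_prop (disch := exact this _)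

lemma radial (R₁ R₂ τ : ℝ) (hR : R₁ < R₂) (hτ : 0 < τ) :
    ∫ r in Set.Ioo R₁ R₂, exp (-τ * r) = (exp (-τ * R₁) - exp (-τ * R₂)) / τ := by
  rw [← integral_Ioc_eq_integral_Ioo, ← intervalIntegral.integral_of_le hR.le]
  rw [intervalIntegral.integral_eq_sub_of_hasDerivAt (f := fun r => -exp (-τ * r) / τ)]
  · ring
  · intro r _
    have := ((((hasDerivAt_id r).const_mul (-τ)).exp).neg).div_const τ
    refine HasDerivAt.congr_deriv this ?_
    simp; field_simp
  · exact Continuous.intervalIntegrable (by fun_prop) _ _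

/-- Formula (3.4), `j = −1`: integral over the annulus `{y : R₁ < |y−p| < R₂}`. -/
theorem stmt_12 (p : EuclideanSpace ℝ (Fin 3)) (R₁ R₂ τ : ℝ)
    (hR₁ : 0 < R₁) (hR : R₁ < R₂) (hτ : 0 < τ)
    (x : EuclideanSpace ℝ (Fin 3)) (hx0 : 0 < ‖x - p‖) (hx : ‖x - p‖ < R₁) :
    (1 / (4 * π)) *
        ∫ y in {y : EuclideanSpace ℝ (Fin 3) | R₁ < ‖y - p‖ ∧ ‖y - p‖ < R₂},
          Real.exp (-τ * ‖x - y‖) / (‖x - y‖ * ‖y - p‖)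
      = (1 / τ ^ 2) * (Real.exp (-τ * R₁) - Real.exp (-τ * R₂)) *
          Real.sinh (τ * ‖x - p‖) / ‖x - p‖ := by
  obtain ⟨d, hd⟩ : ∃ d, d = ‖x - p‖ := ⟨_, rfl⟩
  rw [← hd] at hx0 hx ⊢
  let K : ℝ → ℝ → ℝ := fun s t => if R₁ < s ∧ s < R₂ then exp (-τ * t) / (t * s) else 0
  let G : ℝ → ℝ → ℝ := fun u ρ => K (√(u ^ 2 + ρ ^ 2)) (√((u - d) ^ 2 + ρ ^ 2))
  have e1 : ∫ y in {y : EuclideanSpace ℝ (Fin 3) | R₁ < ‖y - p‖ ∧ ‖y - p‖ < R₂},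
          Real.exp (-τ * ‖x - y‖) / (‖x - y‖ * ‖y - p‖) =
      ∫ y : EuclideanSpace ℝ (Fin 3), K ‖y‖ ‖y - (x - p)‖ := by
    rw [← integral_sub_right_eq_self (fun y => K ‖y‖ ‖y - (x - p)‖) p, ← integral_indicator]
    · congr 1
      ext y
      simp only [Set.indicator_apply, Set.mem_ofPred_eq, K, sub_sub_sub_cancel_right,
        norm_sub_rev x y]
    · have hm : Measurable (fun y : EuclideanSpace ℝ (Fin 3) => ‖y - p‖) := by fun_prop
      exact (measurableSet_lt measurable_const hm).inter
        (measurableSet_lt hm measurable_const)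
  obtain ⟨b, hb⟩ := Orthonormal.exists_orthonormalBasis_extension_of_card_eq (𝕜 := ℝ)
    (E := EuclideanSpace ℝ (Fin 3)) (ι := Fin 3) (by simp)
    (v := fun _ => (d⁻¹ : ℝ) • (x - p)) (s := {0}) (by
      constructor
      · intro i
        simp [Set.domRestrict, norm_smul, ← hd, abs_of_pos hx0, hx0.ne']
      · intro i j hij
        exact absurd (Subsingleton.elim i j) hij)
  have hb0 : x - p = d • b 0 := by
    rw [hb 0 rfl, smul_smul, mul_inv_cancel₀ hx0.ne', one_smul]
  have e2 : ∫ y : EuclideanSpace ℝ (Fin 3), K ‖y‖ ‖y - (x - p)‖ =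
      ∫ w : EuclideanSpace ℝ (Fin 3), G (w 0) (√(w 1 ^ 2 + w 2 ^ 2)) := by
    rw [← b.measurePreserving_repr_symm.integral_comp
      (b.repr.symm.toHomeomorph.measurableEmbedding)]
    congr 1
    ext w
    have n1 : ‖b.repr.symm w‖ = √(w 0 ^ 2 + √(w 1 ^ 2 + w 2 ^ 2) ^ 2) := by
      rw [LinearIsometryEquiv.norm_map, sq_sqrt (by positivity), EuclideanSpace.norm_eq]
      simp [Fin.sum_univ_three, add_assoc]
    have n2 : ‖b.repr.symm w - (x - p)‖ = √((w 0 - d) ^ 2 + √(w 1 ^ 2 + w 2 ^ 2) ^ 2) := by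
      rw [← b.repr.norm_map, map_sub, LinearIsometryEquiv.apply_symm_apply, hb0, map_smul,
        b.repr_self, sq_sqrt (by positivity), EuclideanSpace.norm_eq]
      simp [Fin.sum_univ_three, add_assoc]
    rw [n1, n2]
  have hGm : Measurable (fun q : ℝ × ℝ => G q.1 q.2) := by
    simp only [G, K]
    refine Measurable.ite ?_ (by fun_prop) measurable_const
    have hm : Measurable (fun q : ℝ × ℝ => √(q.1 ^ 2 + q.2 ^ 2)) := by fun_prop
    exact (measurableSet_lt measurable_const hm).inter
        (measurableSet_lt hm measurable_const)
  have hGb : ∀ u ρ, |G u ρ| ≤ 1 / ((R₁ - d) * R₁) := by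
    intro u ρ
    have hRd : 0 < R₁ - d := by linarith
    simp only [G, K]
    split_ifs with h
    · have hs : √(u ^ 2 + ρ ^ 2) ^ 2 = u ^ 2 + ρ ^ 2 := sq_sqrt (by positivity)
      have hus : u ≤ √(u ^ 2 + ρ ^ 2) := le_sqrt_of_sq_le (by nlinarith [sq_nonneg ρ])
      have ht : R₁ - d ≤ √((u - d) ^ 2 + ρ ^ 2) := by
        apply le_sqrt_of_sq_le
        nlinarith
      rw [abs_of_nonneg (by positivity)]
      have : exp (-τ * √((u - d) ^ 2 + ρ ^ 2)) ≤ 1 := by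
        rw [exp_le_one_iff]
        nlinarith [sqrt_nonneg ((u - d) ^ 2 + ρ ^ 2)]
      have := h.1.le
      gcongr
    · simp; positivity
  have hG0 : ∀ u ρ, R₂ ^ 2 ≤ u ^ 2 + ρ ^ 2 → G u ρ = 0 := by
    intro u ρ h
    have := le_sqrt_of_sq_le h
    simp only [G, K]
    rw [if_neg]
    intro h'
    linarith [h'.2]
  have e3 : ∫ r in Set.Ioi (0:ℝ), ∫ θ in Set.Ioo 0 π,
        r ^ 2 * sin θ * G (r * cos θ) (r * sin θ) =
      ∫ r in Set.Ioo R₁ R₂, 2 * sinh (τ * d) / (τ * d) * exp (-τ * r) := by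
    have hsub : Set.Ioo R₁ R₂ ⊆ Set.Ioi 0 := fun r hr => hR₁.trans hr.1
    have hs : ∀ r > 0, ∀ θ, √((r * cos θ) ^ 2 + (r * sin θ) ^ 2) = r := by
      intro r hr θ
      rw [show (r * cos θ) ^ 2 + (r * sin θ) ^ 2 = r ^ 2 * (sin θ ^ 2 + cos θ ^ 2) by ring,
        sin_sq_add_cos_sq, mul_one, sqrt_sq (le_of_lt hr)]
    rw [setIntegral_eq_of_subset_of_forall_sdiff_eq_zero measurableSet_Ioi hsub]
    · refine setIntegral_congr_fun measurableSet_Ioo fun r hr => ?_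
      have hr0 : 0 < r := hsub hr
      have hr' : R₁ < r ∧ r < R₂ := hr
      simp only [G, K, hs r hr0, hr', and_self, if_true]
      have := inner_theta r d τ hx0 (hx.trans hr.1) hτ
      have h5 : ∀ θ, r ^ 2 * sin θ * (exp (-τ * √((r * cos θ - d) ^ 2 + (r * sin θ) ^ 2)) /
          (√((r * cos θ - d) ^ 2 + (r * sin θ) ^ 2) * r)) = r * (sin θ *
          (exp (-τ * √((r * cos θ - d) ^ 2 + (r * sin θ) ^ 2)) /
          √((r * cos θ - d) ^ 2 + (r * sin θ) ^ 2))) := by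
        intro θ
        rw [← div_div]
        field_simp
      simp only [h5]
      rw [integral_const_mul, this]
      field_simp
    · intro r hr
      have hr0 : 0 < r := hr.1
      have hr' : ¬ (R₁ < r ∧ r < R₂) := hr.2
      simp only [G, K, hs r hr0, hr', if_false, mul_zero, integral_zero]
  rw [e1, e2, integral_axial G hGm _ R₂ (hR₁.trans hR) hGb hG0, e3, integral_const_mul,
    radial _ _ _ hR hτ]
  have := pi_pos
  field_simp
  ring
end
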